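/- arXiv:0706.0119 — 11 statements merged into one kernel-verified Lean document; each statement's English description precedes it below -/
import Mathlib

section
/- Let a > 0 and X ∈ ℝ with −√a < X < √a, and set A = a − X². Then (4/3)·∫_X^{√a} (a − x²)^{3/2} dx = (a²/2)·(π/2 − arctan(X/√A)) + ((2X³ − 5aX)/6)·√A. -/
open Real MeasureTheory

theorem sqrt_one_sub_div_sq {s : ℝ} (hs : 0 < s) (x : ℝ) :
    √(1 - (x / s) ^ 2) = √(s ^ 2 - x ^ 2) / s := by
  have h : 1 - (x / s) ^ 2 = (s ^ 2 - x ^ 2) / s ^ 2 := by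
    field_simp
  rw [h, Real.sqrt_div' _ (sq_nonneg s), Real.sqrt_sq hs.le]

theorem rpow_three_halves {y : ℝ} (hy : 0 ≤ y) : y ^ ((3 : ℝ) / 2) = √y ^ 3 := by
  rw [Real.sqrt_eq_rpow, ← Real.rpow_natCast, ← Real.rpow_mul hy]
  norm_num

theorem hasDerivAt_arcsin_sub_poly_mul_sqrt {s x : ℝ} (hx₁ : -s < x) (hx₂ : x < s) :
    HasDerivAt (fun x ↦ s ^ 4 / 2 * arcsin (x / s) -
      (2 * x ^ 3 - 5 * s ^ 2 * x) / 6 * √(s ^ 2 - x ^ 2))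
      (4 / 3 * (s ^ 2 - x ^ 2) ^ ((3 : ℝ) / 2)) x := by
  have hs : 0 < s := by linarith
  have hpos : 0 < s ^ 2 - x ^ 2 := by nlinarith
  have hlt : x / s < 1 := by rwa [div_lt_one hs]
  have hgt : -1 < x / s := by rw [lt_div_iff₀ hs]; linarith
  have hr : 0 < √(s ^ 2 - x ^ 2) := Real.sqrt_pos.2 hpos
  have hr2 : √(s ^ 2 - x ^ 2) ^ 2 = s ^ 2 - x ^ 2 := Real.sq_sqrt hpos.le
  have harcsin := (Real.hasDerivAt_arcsin hgt.ne' hlt.ne).comp x ((hasDerivAt_id x).div_const s)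
  have hsqrt := (((hasDerivAt_id x).pow 2).const_sub (s ^ 2)).sqrt hpos.ne'
  have hpoly := ((((hasDerivAt_id x).pow 3).const_mul 2).sub
    ((hasDerivAt_id x).const_mul (5 * s ^ 2))).div_const 6
  refine ((harcsin.const_mul (s ^ 4 / 2)).sub (hpoly.mul hsqrt)).congr_deriv ?_
  rw [rpow_three_halves hpos.le]
  simp only [sqrt_one_sub_div_sq hs, id, Pi.pow_apply, Pi.sub_apply]
  generalize √(s ^ 2 - x ^ 2) = r at *
  field_simp
  have hr4 : r ^ 4 = (s ^ 2 - x ^ 2) ^ 2 := by rw [← hr2]; ring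
  push_cast
  ring_nf
  ring_nf at hr2 hr4
  simp only [hr2, hr4]
  ring

theorem stmt_0 (a X : ℝ) (ha : 0 < a)
    (h1 : -Real.sqrt a < X) (h2 : X < Real.sqrt a)
    (A : ℝ) (hA : A = a - X ^ 2) :
    (4 / 3) * ∫ x in X..Real.sqrt a, (a - x ^ 2) ^ ((3 : ℝ) / 2) =
      a ^ 2 / 2 * (π / 2 - Real.arctan (X / Real.sqrt A)) +
        (2 * X ^ 3 - 5 * a * X) / 6 * Real.sqrt A := by
  subst hA
  obtain ⟨s, hs, rfl⟩ : ∃ s, 0 < s ∧ a = s ^ 2 :=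
    ⟨√a, Real.sqrt_pos.2 ha, (Real.sq_sqrt ha.le).symm⟩
  rw [Real.sqrt_sq hs.le] at *
  have hint : Continuous fun x : ℝ ↦ 4 / 3 * (s ^ 2 - x ^ 2) ^ ((3 : ℝ) / 2) :=
    continuous_const.mul
      ((by fun_prop : Continuous fun x : ℝ ↦ s ^ 2 - x ^ 2).rpow_const
        fun _ ↦ Or.inr (by norm_num))
  have hcont : Continuous fun x ↦ s ^ 4 / 2 * arcsin (x / s) -
      (2 * x ^ 3 - 5 * s ^ 2 * x) / 6 * √(s ^ 2 - x ^ 2) := by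
    have := Real.continuous_arcsin.comp (continuous_id.div_const s)
    exact (continuous_const.mul this).sub (by fun_prop)
  have harc : arcsin (X / s) = arctan (X / √(s ^ 2 - X ^ 2)) := by
    rw [Real.arcsin_eq_arctan ⟨by rw [lt_div_iff₀ hs]; linarith, by rwa [div_lt_one hs]⟩,
      sqrt_one_sub_div_sq hs, div_div_div_cancel_right₀ hs.ne']
  rw [← intervalIntegral.integral_const_mul,
    intervalIntegral.integral_eq_sub_of_hasDerivAt_of_le h2.le hcont.continuousOn
      (fun x hx ↦ hasDerivAt_arcsin_sub_poly_mul_sqrt (h1.trans hx.1) hx.2)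
      (hint.intervalIntegrable _ _),
    harc, div_self hs.ne', Real.arcsin_one, sub_self, Real.sqrt_zero]
  ring
end

section
/- Let a > 0, X ∈ ℝ with −√a < X < √a, b < 0, and c = a − bX. Set X' = X − b/2, a' = b²/4 − bX + a, and A = a − X². Then the Lebesgue measure (volume) of the oblique paraboloid sector 𝒫₂ = {(x,y,z) ∈ ℝ³ : x² + y² ≤ z, x ≥ X, z ≤ bx + c} equals V(a',X') = (a'²/2)·(π/2 − arctan(X'/√A)) + ((2X'³ − 5a'X')/6)·√A. -/
open Real MeasureTheory

/-- A nonnegative function supported on `[p, q]` has Lebesgue integral equal to its interval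
integral. -/
lemma lintegral_eq_ofReal_intervalIntegral {f : ℝ → ℝ} {g : ℝ → ENNReal} {p q : ℝ} (hpq : p ≤ q)
    (hf : Continuous f) (hf0 : ∀ x ∈ Set.Ioo p q, 0 ≤ f x)
    (hin : ∀ x ∈ Set.Ioo p q, g x = ENNReal.ofReal (f x))
    (hout : ∀ x ∉ Set.Icc p q, g x = 0) :
    ∫⁻ x, g x = ENNReal.ofReal (∫ x in p..q, f x) := by
  have key : g =ᵐ[volume] (Set.Ioo p q).indicator (fun x => ENNReal.ofReal (f x)) := by
    have hp : ∀ᵐ x : ℝ, x ≠ p := Measure.ae_ne volume p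
    have hq : ∀ᵐ x : ℝ, x ≠ q := Measure.ae_ne volume q
    filter_upwards [hp, hq] with x hxp hxq
    by_cases hx : x ∈ Set.Ioo p q
    · rw [Set.indicator_of_mem hx, hin x hx]
    · rw [Set.indicator_of_notMem hx]
      refine hout x fun h => hx ⟨lt_of_le_of_ne h.1 (Ne.symm hxp), lt_of_le_of_ne h.2 hxq⟩
  rw [lintegral_congr_ae key, lintegral_indicator measurableSet_Ioo,
    intervalIntegral.integral_of_le hpq, integral_Ioc_eq_integral_Ioo,
    ofReal_integral_eq_lintegral_ofReal]
  · exact (hf.integrableOn_Icc (a := p) (b := q)).mono_set Set.Ioo_subset_Icc_self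
  · exact (ae_restrict_iff' measurableSet_Ioo).2 (Filter.Eventually.of_forall hf0)

/-- The area under a parabola cap. -/
lemma lintegral_ofReal_sub_sq (w : ℝ) :
    ∫⁻ y : ℝ, ENNReal.ofReal (w - y ^ 2) = ENNReal.ofReal (4 / 3 * √w ^ 3) := by
  have hs := Real.sqrt_nonneg w
  rw [lintegral_eq_ofReal_intervalIntegral (f := fun y => w - y ^ 2) (p := -√w) (q := √w)
    (by linarith) (by fun_prop) _ (fun _ _ => rfl)]
  · congr 1
    rw [intervalIntegral.integral_sub (by simp) (by simp)]
    simp only [intervalIntegral.integral_const, integral_pow, smul_eq_mul]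
    rcases le_total 0 w with hw | hw
    · have := Real.sq_sqrt hw
      push_cast
      linear_combination (-2 * √w) * this
    · simp [Real.sqrt_eq_zero_of_nonpos hw]
  · intro y hy
    rw [ENNReal.ofReal_eq_zero]
    by_contra! h
    exact hy (abs_le.1 (Real.abs_le_sqrt (by linarith)))
  · intro y hy
    have : 0 < √w := by linarith [hy.1, hy.2]
    have hw : 0 < w := Real.sqrt_pos.1 this
    have := Real.sq_sqrt hw.le
    nlinarith [hy.1, hy.2]

/-- The integral of the cross-sectional areas of a right paraboloid sector. -/
lemma integral_sqrt_sub_sq_cube {α ξ : ℝ} (h : 0 < α - ξ ^ 2) :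
    ∫ u in ξ..√α, 4 / 3 * √(α - u ^ 2) ^ 3 =
      α ^ 2 / 2 * (π / 2 - arctan (ξ / √(α - ξ ^ 2))) +
        (2 * ξ ^ 3 - 5 * α * ξ) / 6 * √(α - ξ ^ 2) := by
  have hα : 0 < α := by nlinarith [sq_nonneg ξ]
  have hr : 0 < √α := Real.sqrt_pos.2 hα
  have hr2 : √α ^ 2 = α := Real.sq_sqrt hα.le
  obtain ⟨hξ1, hξ2⟩ : -√α < ξ ∧ ξ < √α :=
    abs_lt.1 (Real.lt_sqrt_of_sq_lt (by rw [sq_abs]; linarith))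
  have hsq : ∀ u, √(1 - (u / √α) ^ 2) = √(α - u ^ 2) / √α := fun u => by
    rw [← Real.sqrt_div' _ hα.le]
    congr 1
    rw [div_pow, hr2]
    field_simp
  have hd : ∀ u ∈ Set.Ioo ξ √α, HasDerivAt (fun u => -(α ^ 2 / 2 * (π / 2 - arcsin (u / √α)) +
      (2 * u ^ 3 - 5 * α * u) / 6 * √(α - u ^ 2))) (4 / 3 * √(α - u ^ 2) ^ 3) u := by
    intro u hu
    have hpos : 0 < α - u ^ 2 := by nlinarith [hu.1, hu.2]
    have hs : 0 < √(α - u ^ 2) := Real.sqrt_pos.2 hpos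
    have hs2 := Real.sq_sqrt hpos.le
    have hu1 : u / √α ≠ -1 := by
      intro h; rw [div_eq_iff hr.ne'] at h; linarith [hu.1]
    have hu2 : u / √α ≠ 1 := by
      intro h; rw [div_eq_iff hr.ne'] at h; linarith [hu.2]
    have d1 : HasDerivAt (fun u => arcsin (u / √α)) (1 / √(α - u ^ 2)) u := by
      refine ((Real.hasDerivAt_arcsin hu1 hu2).comp u
        ((hasDerivAt_id' u).div_const √α)).congr_deriv ?_
      rw [hsq]
      field_simp
    have d2 : HasDerivAt (fun u => √(α - u ^ 2)) (-u / √(α - u ^ 2)) u := by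
      refine (((hasDerivAt_pow 2 u).const_sub α).sqrt hpos.ne').congr_deriv ?_
      push_cast
      field_simp
    have d3 : HasDerivAt (fun u => (2 * u ^ 3 - 5 * α * u) / 6) ((6 * u ^ 2 - 5 * α) / 6) u := by
      refine ((((hasDerivAt_pow 3 u).const_mul 2).sub
        ((hasDerivAt_id' u).const_mul (5 * α))).div_const 6).congr_deriv ?_
      push_cast
      ring
    refine (((d1.const_sub (π / 2)).const_mul (α ^ 2 / 2)).add (d3.mul d2)).neg.congr_deriv ?_
    generalize √(α - u ^ 2) = s at *
    have : α = s ^ 2 + u ^ 2 := by linarith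
    subst this
    field_simp
    ring
  rw [intervalIntegral.integral_eq_sub_of_hasDerivAt_of_le hξ2.le
    (by fun_prop) hd (Continuous.intervalIntegrable (by fun_prop) _ _)]
  have harc : arcsin (ξ / √α) = arctan (ξ / √(α - ξ ^ 2)) := by
    rw [Real.arcsin_eq_arctan, hsq]
    · congr 1
      have := Real.sqrt_pos.2 h
      field_simp
    · constructor
      · rw [lt_div_iff₀ hr]; linarith
      · rw [div_lt_one hr]; exact hξ2
  simp only [harc, div_self hr.ne', Real.arcsin_one, hr2]
  simp

theorem stmt_4 (a X b : ℝ) (ha : 0 < a)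
    (h1 : -Real.sqrt a < X) (h2 : X < Real.sqrt a) (hb : b < 0)
    (c : ℝ) (hc : c = a - b * X)
    (X' a' A : ℝ) (hX' : X' = X - b / 2) (ha' : a' = b ^ 2 / 4 - b * X + a)
    (hA : A = a - X ^ 2) :
    (volume {p : ℝ × ℝ × ℝ |
        p.1 ^ 2 + p.2.1 ^ 2 ≤ p.2.2 ∧ X ≤ p.1 ∧ p.2.2 ≤ b * p.1 + c}).toReal =
      a' ^ 2 / 2 * (π / 2 - Real.arctan (X' / Real.sqrt A)) +
        (2 * X' ^ 3 - 5 * a' * X') / 6 * Real.sqrt A := by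
  have hA0 : 0 < A := by
    have := Real.sq_sqrt ha.le
    nlinarith
  have hAe : A = a' - X' ^ 2 := by subst hA hX' ha'; ring
  have hsub : ∀ x, b * x + c - x ^ 2 = a' - (x - b / 2) ^ 2 := fun x => by
    subst hc ha'; ring
  have hX'lt : X' ≤ √a' := Real.le_sqrt_of_sq_le (by linarith)
  have hslice : ∀ x, volume {p : ℝ × ℝ | x ^ 2 + p.1 ^ 2 ≤ p.2 ∧ p.2 ≤ b * x + c} =
      ENNReal.ofReal (4 / 3 * √(a' - (x - b / 2) ^ 2) ^ 3) := by
    intro x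
    have hm : MeasurableSet {p : ℝ × ℝ | x ^ 2 + p.1 ^ 2 ≤ p.2 ∧ p.2 ≤ b * x + c} := by
      simp only [Set.ofPred_and]
      exact ((isClosed_le (by fun_prop) (by fun_prop)).inter
        (isClosed_le (by fun_prop) (by fun_prop))).measurableSet
    rw [Measure.volume_eq_prod, Measure.prod_apply hm, ← lintegral_ofReal_sub_sq]
    refine lintegral_congr fun y => ?_
    change volume (Set.Icc (x ^ 2 + y ^ 2) (b * x + c)) = _
    rw [Real.volume_Icc, ← hsub]
    congr 1
    ring
  have hm : MeasurableSet {p : ℝ × ℝ × ℝ |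
      p.1 ^ 2 + p.2.1 ^ 2 ≤ p.2.2 ∧ X ≤ p.1 ∧ p.2.2 ≤ b * p.1 + c} := by
    simp only [Set.ofPred_and]
    exact ((isClosed_le (by fun_prop) (by fun_prop)).inter
      ((isClosed_le (by fun_prop) (by fun_prop)).inter
        (isClosed_le (by fun_prop) (by fun_prop)))).measurableSet
  have hIci : ∀ x, X ≤ x → volume (Prod.mk x ⁻¹' {p : ℝ × ℝ × ℝ |
      p.1 ^ 2 + p.2.1 ^ 2 ≤ p.2.2 ∧ X ≤ p.1 ∧ p.2.2 ≤ b * p.1 + c}) =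
      ENNReal.ofReal (4 / 3 * √(a' - (x - b / 2) ^ 2) ^ 3) := by
    intro x hx
    rw [← hslice]
    congr 1
    ext p
    simp [hx]
  rw [Measure.volume_eq_prod, Measure.prod_apply hm,
    lintegral_eq_ofReal_intervalIntegral (p := X) (q := √a' + b / 2)
      (f := fun x => 4 / 3 * √(a' - (x - b / 2) ^ 2) ^ 3) (by linarith) (by fun_prop)
      (fun x _ => by positivity) (fun x hx => hIci x hx.1.le)]
  · rw [ENNReal.toReal_ofReal (intervalIntegral.integral_nonneg (by linarith)
      fun x _ => by positivity),
      intervalIntegral.integral_comp_sub_right (fun u => 4 / 3 * √(a' - u ^ 2) ^ 3) (b / 2),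
      add_sub_cancel_right, ← hX', integral_sqrt_sub_sq_cube (hAe ▸ hA0), ← hAe]
  · intro x hx
    by_cases hXx : X ≤ x
    · have hlt : √a' < x - b / 2 := by
        by_contra! h
        exact hx ⟨hXx, by linarith⟩
      rw [hIci x hXx, Real.sqrt_eq_zero_of_nonpos]
      · simp
      · linarith [(Real.sqrt_lt' ((Real.sqrt_nonneg a').trans_lt hlt)).1 hlt]
    · convert measure_empty (μ := (volume : Measure (ℝ × ℝ)))
      ext p
      simp [hXx]
end

section
/- (Theorem 1.) Let a > 0, 0 < σ < 1, X ∈ ℝ with −√a < X < √a, b < 0, c = a − bX, A = a − X², X' = X − b/2, a' = b²/4 − bX + a. Let 𝒫' = {(x,y,z) ∈ ℝ³ : x² + y² ≤ z, z ≤ a, z ≥ bx + c}, let B' ∈ ℝ³ be the centroid (center of mass with respect to Lebesgue measure) of 𝒫', and let B = (0, 0, 2a/3). Define V₁ = (a²/2)(π/2 − arctan(X/√A)) + ((2X³ − 5aX)/6)√A, V₂ = (a'²/2)(π/2 − arctan(X'/√A)) + ((2X'³ − 5a'X')/6)√A, E = (5b²/12 − 2bX/3 + 1/2)·V₂ + (2b/9)·A^{5/2},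 and F = V₁ − V₂ − σ·a²π/2. Then: B − B' is a scalar multiple of the normal vector (b, 0, −1) of the plane {z = bx + c} and the volume of 𝒫' equals σ·a²π/2, if and only if E = 0 and F = 0. -/
open Real MeasureTheory

/-- The volume of the part `X ≤ x` of the paraboloid segment `x² + y² ≤ z ≤ a`. -/
noncomputable def segmentVolume (a X : ℝ) : ℝ :=
  a ^ 2 / 2 * (π / 2 - Real.arcsin (X / √a)) + (2 * X ^ 3 - 5 * a * X) / 6 * √(a - X ^ 2)

lemma sqrt_one_sub_div_sqrt_sq {a : ℝ} (ha : 0 < a) (u : ℝ) :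
    √(1 - (u / √a) ^ 2) = √(a - u ^ 2) / √a := by
  rw [← Real.sqrt_div' _ ha.le, div_pow, Real.sq_sqrt ha.le]
  congr 1
  field_simp

lemma segmentVolume_eq_arctan {a X : ℝ} (h : X ^ 2 < a) :
    segmentVolume a X = a ^ 2 / 2 * (π / 2 - Real.arctan (X / √(a - X ^ 2))) +
      (2 * X ^ 3 - 5 * a * X) / 6 * √(a - X ^ 2) := by
  have ha : 0 < a := (sq_nonneg X).trans_lt h
  have hs : 0 < √a := Real.sqrt_pos.2 ha
  have hX := Real.sq_lt.1 h
  have hm : X / √a ∈ Set.Ioo (-1 : ℝ) 1 := by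
    constructor
    · rw [lt_div_iff₀ hs]; linarith
    · rw [div_lt_one hs]; exact hX.2
  have hd := sqrt_one_sub_div_sqrt_sq ha X
  rw [segmentVolume, Real.arcsin_eq_arctan hm, hd, div_div_div_cancel_right₀ hs.ne']

lemma hasDerivAt_sqrt_sub_sq {a u : ℝ} (h : u ^ 2 < a) :
    HasDerivAt (fun u => √(a - u ^ 2)) (-u / √(a - u ^ 2)) u := by
  have h0 : a - u ^ 2 ≠ 0 := by linarith
  have := ((hasDerivAt_pow 2 u).const_sub a).sqrt h0
  refine this.congr_deriv ?_
  have : √(a - u ^ 2) ≠ 0 := (Real.sqrt_pos.2 (by linarith)).ne'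
  field_simp
  norm_num

lemma hasDerivAt_segmentVolume {a u : ℝ} (h : u ^ 2 < a) :
    HasDerivAt (segmentVolume a) (-(4 / 3) * √(a - u ^ 2) ^ 3) u := by
  have ha : 0 < a := (sq_nonneg u).trans_lt h
  have hs : 0 < √a := Real.sqrt_pos.2 ha
  have hX := Real.sq_lt.1 h
  have h1 : u / √a ≠ -1 := by
    intro h; rw [div_eq_iff hs.ne'] at h; linarith
  have h2 : u / √a ≠ 1 := by
    intro h; rw [div_eq_iff hs.ne'] at h; linarith
  have hd := sqrt_one_sub_div_sqrt_sq ha u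
  have hasin : HasDerivAt (fun u => Real.arcsin (u / √a)) (1 / √(a - u ^ 2)) u := by
    have := (Real.hasDerivAt_arcsin h1 h2).comp u ((hasDerivAt_id u).div_const (√a))
    rw [hd] at this
    refine this.congr_deriv ?_
    field_simp
  have hpoly : HasDerivAt (fun u : ℝ => (2 * u ^ 3 - 5 * a * u) / 6) ((6 * u ^ 2 - 5 * a) / 6) u := by
    have := ((((hasDerivAt_pow 3 u).const_mul 2).sub ((hasDerivAt_id u).const_mul (5 * a))).div_const 6)
    refine this.congr_deriv ?_
    norm_num
    ring
  have := ((hasin.const_sub (π / 2)).const_mul (a ^ 2 / 2)).add (hpoly.mul (hasDerivAt_sqrt_sub_sq h))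
  refine this.congr_deriv ?_
  have hpos : 0 < √(a - u ^ 2) := Real.sqrt_pos.2 (by linarith)
  have hsq : √(a - u ^ 2) ^ 2 = a - u ^ 2 := Real.sq_sqrt (by linarith)
  set s := √(a - u ^ 2)
  have hae : a = s ^ 2 + u ^ 2 := by linarith
  rw [hae]
  field_simp
  ring

lemma continuous_segmentVolume (a : ℝ) : Continuous (segmentVolume a) := by
  unfold segmentVolume
  have := Real.continuous_arcsin
  fun_prop

/-- The integral over `x` of the moments of the parabolic slices. -/
lemma integral_slice_moments {a X : ℝ} (h : X ^ 2 < a) (k β γ : ℝ) :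
    ∫ u in X..√a, ((k + β * u) * (4 / 3 * √(a - u ^ 2) ^ 3) - γ * (8 / 15) * √(a - u ^ 2) ^ 5) =
      (k - γ * a / 3) * segmentVolume a X +
        (4 / 15 * β + 4 / 45 * γ * X) * √(a - X ^ 2) ^ 5 := by
  have ha : 0 < a := (sq_nonneg X).trans_lt h
  have hX := Real.sq_lt.1 h
  have hc := continuous_segmentVolume a
  have key := intervalIntegral.integral_eq_sub_of_hasDerivAt_of_le
    (f := fun u => -((k - γ * a / 3) * segmentVolume a u +
        (4 / 15 * β + 4 / 45 * γ * u) * √(a - u ^ 2) ^ 5))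
    (f' := fun u => (k + β * u) * (4 / 3 * √(a - u ^ 2) ^ 3) - γ * (8 / 15) * √(a - u ^ 2) ^ 5)
    hX.2.le (by fun_prop) ?_ (Continuous.intervalIntegrable (by fun_prop) _ _)
  · rw [key]
    simp [segmentVolume, Real.sq_sqrt ha.le, div_self (Real.sqrt_pos.2 ha).ne']
  · intro u hu
    have hu2 : u ^ 2 < a := by
      rw [← Real.sqrt_lt_sqrt_iff (sq_nonneg u), Real.sqrt_sq_eq_abs, abs_lt]
      exact ⟨hX.1.trans hu.1, hu.2⟩
    have hlin : HasDerivAt (fun u : ℝ => 4 / 15 * β + 4 / 45 * γ * u) (4 / 45 * γ) u := by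
      simpa using ((hasDerivAt_id u).const_mul (4 / 45 * γ)).const_add (4 / 15 * β)
    have := (((hasDerivAt_segmentVolume hu2).const_mul (k - γ * a / 3)).add
      (hlin.mul ((hasDerivAt_sqrt_sub_sq hu2).pow 5))).neg
    refine this.congr_deriv ?_
    have hpos : 0 < √(a - u ^ 2) := Real.sqrt_pos.2 (by linarith)
    have hsq : √(a - u ^ 2) ^ 2 = a - u ^ 2 := Real.sq_sqrt (by linarith)
    simp only [Pi.pow_apply]
    set s := √(a - u ^ 2)
    have hae : a = s ^ 2 + u ^ 2 := by linarith
    rw [hae]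
    norm_num
    field_simp
    ring

lemma integral_affine (k γ p q : ℝ) :
    ∫ z in p..q, (k + γ * z) = (k + γ * q) * (q - p) - γ / 2 * (q - p) ^ 2 := by
  have hd : ∀ z : ℝ, HasDerivAt (fun z => k * z + γ * (z ^ 2 / 2)) (k + γ * z) z := by
    intro z
    have := ((hasDerivAt_id z).const_mul k).add (((hasDerivAt_pow 2 z).div_const 2).const_mul γ)
    refine this.congr_deriv ?_
    norm_num
  rw [intervalIntegral.integral_eq_sub_of_hasDerivAt (fun z _ => hd z)
    (Continuous.intervalIntegrable (by fun_prop) _ _)]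
  ring

lemma integral_parabola_moments (k δ γ s : ℝ) :
    ∫ y in -s..s, ((k + δ * y) * (s ^ 2 - y ^ 2) - γ / 2 * (s ^ 2 - y ^ 2) ^ 2) =
      k * (4 / 3 * s ^ 3) - γ * (8 / 15) * s ^ 5 := by
  have hd : ∀ y : ℝ, HasDerivAt (fun y => k * (s ^ 2 * y - y ^ 3 / 3) +
      δ * (s ^ 2 * y ^ 2 / 2 - y ^ 4 / 4) -
      γ / 2 * (s ^ 4 * y - 2 * s ^ 2 * y ^ 3 / 3 + y ^ 5 / 5))
      ((k + δ * y) * (s ^ 2 - y ^ 2) - γ / 2 * (s ^ 2 - y ^ 2) ^ 2) y := by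
    intro y
    have h1 := hasDerivAt_id y
    have h2 := hasDerivAt_pow 2 y
    have h3 := hasDerivAt_pow 3 y
    have h4 := hasDerivAt_pow 4 y
    have h5 := hasDerivAt_pow 5 y
    have := (((((h1.const_mul (s ^ 2)).sub (h3.div_const 3)).const_mul k).add
      ((((h2.const_mul (s ^ 2)).div_const 2).sub (h4.div_const 4)).const_mul δ)).sub
      ((((h1.const_mul (s ^ 4)).sub ((h3.const_mul (2 * s ^ 2)).div_const 3)).add
        (h5.div_const 5)).const_mul (γ / 2)))
    refine this.congr_deriv ?_
    norm_num
    ring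
  rw [intervalIntegral.integral_eq_sub_of_hasDerivAt (fun y _ => hd y)
    (Continuous.intervalIntegrable (by fun_prop) _ _)]
  ring

/-- The part `X ≤ x` of the solid `x² + y² ≤ z ≤ b x + c`. -/
def cutSegment (b c X : ℝ) : Set (ℝ × ℝ × ℝ) :=
  {p | X ≤ p.1 ∧ p.1 ^ 2 + p.2.1 ^ 2 ≤ p.2.2 ∧ p.2.2 ≤ b * p.1 + c}

lemma measurableSet_cutSegment (b c X : ℝ) : MeasurableSet (cutSegment b c X) := by
  apply IsClosed.measurableSet
  simp only [cutSegment, Set.ofPred_and]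
  refine (isClosed_le ?_ ?_).inter ((isClosed_le ?_ ?_).inter (isClosed_le ?_ ?_)) <;> fun_prop

lemma integrableOn_cutSegment {E : Type*} [NormedAddCommGroup E] {f : ℝ × ℝ × ℝ → E}
    (hf : Continuous f) (b c X : ℝ) : IntegrableOn f (cutSegment b c X) := by
  set r := √(b ^ 2 / 4 + c)
  have hK : IsCompact (Set.Icc ((b / 2 - r, -r, 0) : ℝ × ℝ × ℝ)
      (b / 2 + r, r, |b| * (|b| / 2 + r) + c)) := isCompact_Icc
  refine (hf.continuousOn.integrableOn_compact hK).mono_set ?_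
  rintro ⟨x, y, z⟩ ⟨-, h1, h2⟩
  simp only at h1 h2
  have hx : |x - b / 2| ≤ r := Real.abs_le_sqrt (by nlinarith [sq_nonneg y])
  have hy : |y| ≤ r := Real.abs_le_sqrt (by nlinarith [sq_nonneg (x - b / 2)])
  have hxb : |x| ≤ |b| / 2 + r := by
    calc |x| = |b / 2 + (x - b / 2)| := by ring_nf
      _ ≤ |b / 2| + |x - b / 2| := abs_add_le _ _
      _ ≤ |b| / 2 + r := by rw [abs_div, abs_two]; gcongr
  have hz : b * x ≤ |b| * (|b| / 2 + r) :=
    (le_abs_self _).trans (by rw [abs_mul]; gcongr)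
  rw [abs_le] at hx hy
  simp only [Set.mem_Icc, Prod.mk_le_mk]
  refine ⟨⟨?_, ?_, ?_⟩, ?_, ?_, ?_⟩ <;> nlinarith

/-- First moments of a solid which agrees with `cutSegment b c X` up to its upper face. -/
lemma setIntegral_affine_of_cutSegment {b c X : ℝ} (hA : X ^ 2 < b * X + c)
    {R : Set (ℝ × ℝ × ℝ)} (hRm : MeasurableSet R) (hR : R ⊆ cutSegment b c X)
    (hR' : ∀ p ∈ cutSegment b c X, p.2.2 < b * p.1 + c → p ∈ R) (α β δ γ : ℝ) :
    ∫ p in R, (α + β * p.1 + δ * p.2.1 + γ * p.2.2) =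
      (α + β * (b / 2) + γ * (c + b ^ 2 / 2) - γ * (b ^ 2 / 4 + c) / 3) *
          segmentVolume (b ^ 2 / 4 + c) (X - b / 2) +
        (4 / 15 * (β + γ * b) + 4 / 45 * γ * (X - b / 2)) * √(b * X + c - X ^ 2) ^ 5 := by
  set f : ℝ × ℝ × ℝ → ℝ := fun p => α + β * p.1 + δ * p.2.1 + γ * p.2.2
  have hfc : Continuous f := by fun_prop
  have hint : Integrable (R.indicator f) :=
    ((integrableOn_cutSegment hfc b c X).mono_set hR).integrable_indicator hRm
  set a' := b ^ 2 / 4 + c with ha'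
  have hX' : (X - b / 2) ^ 2 < a' := by nlinarith
  have hX'' := Real.sq_lt.1 hX'
  have ha'0 : 0 < a' := (sq_nonneg _).trans_lt hX'
  -- slices in the direction of the `z`-axis
  have hzslice : ∀ x y : ℝ, ∫ z, R.indicator f (x, y, z) =
      if X ≤ x ∧ x ^ 2 + y ^ 2 ≤ b * x + c then
        (α + β * x + γ * (b * x + c) + δ * y) * (b * x + c - x ^ 2 - y ^ 2) -
          γ / 2 * (b * x + c - x ^ 2 - y ^ 2) ^ 2 else 0 := by
    intro x y
    split_ifs with hxy
    · have h1 : (fun z => R.indicator f (x, y, z)) =ᵐ[volume]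
          (Set.Ioc (x ^ 2 + y ^ 2) (b * x + c)).indicator (fun z => (α + β * x + δ * y) + γ * z) := by
        have hne : ∀ t : ℝ, ∀ᵐ z : ℝ, z ≠ t := fun t => by
          simp [ae_iff, measure_singleton]
        filter_upwards [hne (x ^ 2 + y ^ 2), hne (b * x + c)] with z hz1 hz2
        by_cases hz : z ∈ Set.Ioc (x ^ 2 + y ^ 2) (b * x + c)
        · have : (x, y, z) ∈ R :=
            hR' _ ⟨hxy.1, hz.1.le, hz.2⟩ (lt_of_le_of_ne hz.2 hz2)
          rw [Set.indicator_of_mem this, Set.indicator_of_mem hz]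
        · have : (x, y, z) ∉ R := fun hmem =>
            hz ⟨lt_of_le_of_ne (hR hmem).2.1 hz1.symm, (hR hmem).2.2⟩
          rw [Set.indicator_of_notMem this, Set.indicator_of_notMem hz]
      rw [integral_congr_ae h1, integral_indicator measurableSet_Ioc,
        ← intervalIntegral.integral_of_le hxy.2, integral_affine]
      ring
    · have h1 : (fun z => R.indicator f (x, y, z)) = fun _ => 0 := by
        funext z
        refine Set.indicator_of_notMem (fun hmem => hxy ⟨(hR hmem).1, ?_⟩) _
        exact (hR hmem).2.1.trans (hR hmem).2.2
      rw [h1, integral_zero]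
  -- slices orthogonal to the `x`-axis
  have hyslice : ∀ x : ℝ, ∫ y, ∫ z, R.indicator f (x, y, z) =
      (Set.Icc X (b / 2 + √a')).indicator (fun x =>
        (α + β * x + γ * (b * x + c)) * (4 / 3 * √(a' - (x - b / 2) ^ 2) ^ 3) -
          γ * (8 / 15) * √(a' - (x - b / 2) ^ 2) ^ 5) x := by
    intro x
    simp only [hzslice]
    have hh : a' - (x - b / 2) ^ 2 = b * x + c - x ^ 2 := by rw [ha']; ring
    by_cases hx : x ∈ Set.Icc X (b / 2 + √a')
    · rw [Set.indicator_of_mem hx]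
      have hnn : 0 ≤ a' - (x - b / 2) ^ 2 := by
        have : (x - b / 2) ^ 2 ≤ √a' ^ 2 :=
          sq_le_sq' (by linarith [hx.1]) (by linarith [hx.2])
        rw [Real.sq_sqrt ha'0.le] at this
        linarith
      have hsq := Real.sq_sqrt hnn
      have hs0 := Real.sqrt_nonneg (a' - (x - b / 2) ^ 2)
      set s := √(a' - (x - b / 2) ^ 2)
      rw [← integral_parabola_moments _ δ, intervalIntegral.integral_of_le (by linarith),
        ← integral_Icc_eq_integral_Ioc, ← integral_indicator measurableSet_Icc]
      congr 1
      funext y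
      have hiff : (X ≤ x ∧ x ^ 2 + y ^ 2 ≤ b * x + c) ↔ y ∈ Set.Icc (-s) s := by
        rw [Set.mem_Icc, ← abs_le, ← sq_le_sq₀ (abs_nonneg y) hs0, sq_abs, hsq, hh]
        constructor
        · intro h; linarith [h.2]
        · intro h; exact ⟨hx.1, by linarith⟩
      rw [Set.indicator_apply]
      simp only [hiff, hsq, hh]
    · rw [Set.indicator_of_notMem hx]
      refine integral_eq_zero_of_ae (Filter.Eventually.of_forall fun y => ?_)
      refine if_neg fun h => hx ⟨h.1, ?_⟩
      have := Real.abs_le_sqrt (x := x - b / 2) (y := a') (by nlinarith [sq_nonneg y, h.2])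
      linarith [(abs_le.1 this).2]
  rw [← integral_indicator hRm, Measure.volume_eq_prod, integral_prod _ hint]
  have hae : ∀ᵐ x : ℝ, ∫ q, R.indicator f (x, q) = ∫ y, ∫ z, R.indicator f (x, y, z) := by
    filter_upwards [Integrable.prod_right_ae (μ := volume) (ν := volume) hint] with x hx
    rw [Measure.volume_eq_prod, integral_prod _ hx]
  rw [integral_congr_ae hae]
  simp only [hyslice]
  rw [integral_indicator measurableSet_Icc, integral_Icc_eq_integral_Ioc,
    ← intervalIntegral.integral_of_le (by linarith)]
  have hshift := intervalIntegral.integral_comp_sub_right (a := X) (b := b / 2 + √a')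
    (fun u => (α + β * (b / 2) + γ * (c + b ^ 2 / 2) + (β + γ * b) * u) *
      (4 / 3 * √(a' - u ^ 2) ^ 3) - γ * (8 / 15) * √(a' - u ^ 2) ^ 5) (b / 2)
  rw [add_sub_cancel_left, integral_slice_moments hX'] at hshift
  have hS : a' - (X - b / 2) ^ 2 = b * X + c - X ^ 2 := by rw [ha']; ring
  rw [hS] at hshift
  rw [← hshift]
  congr 1
  funext x
  ring

theorem stmt_6 (a σ X b : ℝ) (ha : 0 < a) (hσ0 : 0 < σ) (hσ1 : σ < 1)
    (h1 : -Real.sqrt a < X) (h2 : X < Real.sqrt a) (hb : b < 0)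
    (c : ℝ) (hc : c = a - b * X)
    (A : ℝ) (hA : A = a - X ^ 2)
    (X' : ℝ) (hX' : X' = X - b / 2)
    (a' : ℝ) (ha' : a' = b ^ 2 / 4 - b * X + a)
    (P' : Set (ℝ × ℝ × ℝ))
    (hP' : P' = {p | p.1 ^ 2 + p.2.1 ^ 2 ≤ p.2.2 ∧ p.2.2 ≤ a ∧ b * p.1 + c ≤ p.2.2})
    (B' : ℝ × ℝ × ℝ)
    (hB' : B' = ((volume P').toReal)⁻¹ • ∫ p in P', p)
    (B : ℝ × ℝ × ℝ) (hB : B = (0, 0, 2 * a / 3))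
    (V₁ V₂ E F : ℝ)
    (hV₁ : V₁ = a ^ 2 / 2 * (π / 2 - Real.arctan (X / Real.sqrt A)) +
        (2 * X ^ 3 - 5 * a * X) / 6 * Real.sqrt A)
    (hV₂ : V₂ = a' ^ 2 / 2 * (π / 2 - Real.arctan (X' / Real.sqrt A)) +
        (2 * X' ^ 3 - 5 * a' * X') / 6 * Real.sqrt A)
    (hE : E = (5 * b ^ 2 / 12 - 2 * b * X / 3 + 1 / 2) * V₂ +
        2 * b / 9 * A ^ ((5 : ℝ) / 2))
    (hF : F = V₁ - V₂ - σ * a ^ 2 * π / 2) :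
    ((∃ t : ℝ, B - B' = t • ((b, 0, -1) : ℝ × ℝ × ℝ)) ∧
        (volume P').toReal = σ * a ^ 2 * π / 2) ↔ (E = 0 ∧ F = 0) := by
  have hX2 : X ^ 2 < a := by
    have := sq_lt_sq' h1 h2
    rwa [Real.sq_sqrt ha.le] at this
  subst hc hA hX' ha'
  have hS : b * X + (a - b * X) - X ^ 2 = a - X ^ 2 := by ring
  have hP'm : MeasurableSet P' := by
    rw [hP']
    apply IsClosed.measurableSet
    simp only [Set.ofPred_and]
    refine (isClosed_le ?_ ?_).inter ((isClosed_le ?_ ?_).inter (isClosed_le ?_ ?_)) <;> fun_prop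
  have hsub : P' ⊆ cutSegment 0 a X := by
    rw [hP']
    rintro ⟨x, y, z⟩ ⟨hp1, hp2, hp3⟩
    simp only at hp1 hp2 hp3
    refine ⟨?_, hp1, by simpa using hp2⟩
    by_contra! hlt
    simp only at hlt
    nlinarith
  have hsub2 : cutSegment 0 a X \ P' ⊆ cutSegment b (a - b * X) X := by
    rintro ⟨x, y, z⟩ ⟨⟨hp1, hp2, hp3⟩, hp⟩
    refine ⟨hp1, hp2, ?_⟩
    by_contra! hlt
    refine hp ?_
    rw [hP']
    exact ⟨hp2, by simpa using hp3, hlt.le⟩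
  have hsub3 : ∀ p ∈ cutSegment b (a - b * X) X, p.2.2 < b * p.1 + (a - b * X) →
      p ∈ cutSegment 0 a X \ P' := by
    rintro ⟨x, y, z⟩ ⟨hp1, hp2, hp3⟩ hlt
    simp only at hp1 hp2 hp3 hlt
    refine ⟨⟨hp1, hp2, ?_⟩, ?_⟩
    · simp only
      nlinarith
    · rw [hP']
      rintro ⟨-, -, h⟩
      exact absurd hlt (not_lt.2 h)
  have hm1 := measurableSet_cutSegment 0 a X
  have hmom : ∀ α β δ γ : ℝ, ∫ p in P', (α + β * p.1 + δ * p.2.1 + γ * p.2.2) =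
      ((α + γ * a - γ * a / 3) * V₁ +
        (4 / 15 * β + 4 / 45 * γ * X) * √(a - X ^ 2) ^ 5) -
      ((α + β * (b / 2) + γ * (a - b * X + b ^ 2 / 2) - γ * (b ^ 2 / 4 - b * X + a) / 3) * V₂ +
        (4 / 15 * (β + γ * b) + 4 / 45 * γ * (X - b / 2)) * √(a - X ^ 2) ^ 5) := by
    intro α β δ γ
    have e1 := setIntegral_affine_of_cutSegment (b := 0) (c := a) (X := X) (by linarith)
      hm1 subset_rfl (fun p hp _ => hp) α β δ γ
    have e2 := setIntegral_affine_of_cutSegment (by linarith) (hm1.diff hP'm) hsub2 hsub3 α β δ γ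
    have e3 := setIntegral_sdiff hP'm (integrableOn_cutSegment
      (f := fun p => α + β * p.1 + δ * p.2.1 + γ * p.2.2) (by fun_prop) 0 a X) hsub
    have ev1 : V₁ = segmentVolume a X := by rw [hV₁, segmentVolume_eq_arctan hX2]
    have hA' : b ^ 2 / 4 - b * X + a - (X - b / 2) ^ 2 = a - X ^ 2 := by ring
    have ev2 : V₂ = segmentVolume (b ^ 2 / 4 - b * X + a) (X - b / 2) := by
      rw [hV₂, segmentVolume_eq_arctan (by linarith), hA']
    rw [ev1, ev2]
    rw [hS, show b ^ 2 / 4 + (a - b * X) = b ^ 2 / 4 - b * X + a by ring] at e2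
    norm_num at e1
    rw [e1, e2] at e3
    linarith
  have hvol : (volume P').toReal = V₁ - V₂ := by
    have := hmom 1 0 0 0
    simp only [zero_mul, add_zero, mul_zero, setIntegral_const] at this
    simp only [smul_eq_mul, mul_one, measureReal_def] at this
    rw [this]
    ring
  have hid : IntegrableOn (fun p : ℝ × ℝ × ℝ => p) P' :=
    (integrableOn_cutSegment continuous_id 0 a X).mono_set hsub
  have hI1 : (∫ p in P', p).1 = ∫ p in P', p.1 := fst_integral hid
  have hI2 : (∫ p in P', p).2.1 = ∫ p in P', p.2.1 := by
    rw [snd_integral hid, fst_integral hid.snd]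
  have hI3 : (∫ p in P', p).2.2 = ∫ p in P', p.2.2 := by
    rw [snd_integral hid, snd_integral hid.snd]
  have hx := hmom 0 1 0 0
  have hy := hmom 0 0 1 0
  have hz := hmom 0 0 0 1
  simp only [zero_mul, one_mul, add_zero, zero_add] at hx hy hz
  rw [← hI1] at hx
  rw [← hI2] at hy
  rw [← hI3] at hz
  have hpow : (a - X ^ 2) ^ ((5 : ℝ) / 2) = √(a - X ^ 2) ^ 5 := by
    rw [Real.sqrt_eq_rpow, ← Real.rpow_mul_natCast (by linarith)]
    norm_num
  rw [hpow] at hE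
  have hmoment : b * (∫ p in P', p).2.2 + (∫ p in P', p).1 - 2 * a * b / 3 * (V₁ - V₂) = -b * E := by
    rw [hx, hz, hE]
    ring
  have hy0 : (∫ p in P', p).2.1 = 0 := by
    rw [hy]
    ring
  rw [hvol]
  have hF' : V₁ - V₂ = σ * a ^ 2 * π / 2 ↔ F = 0 := by
    rw [hF, sub_eq_zero]
  rw [← hF']
  refine and_congr_left fun hV => ?_
  have hVpos : 0 < V₁ - V₂ := by rw [hV]; positivity
  rw [hvol] at hB'
  set I := ∫ p in P', p
  set v := V₁ - V₂
  have hEiff : E = 0 ↔ b * I.2.2 + I.1 - 2 * a * b / 3 * v = 0 := by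
    rw [hmoment]
    simp [hb.ne]
  rw [hEiff, hB, hB']
  have hcoord : ∀ t : ℝ, ((0, 0, 2 * a / 3) : ℝ × ℝ × ℝ) - v⁻¹ • I = t • (b, 0, -1) ↔
      -(v⁻¹ * I.1) = t * b ∧ 2 * a / 3 - v⁻¹ * I.2.2 = -t := by
    intro t
    simp [Prod.ext_iff, hy0]
  simp only [hcoord]
  constructor
  · rintro ⟨t, ht1, ht2⟩
    have ht : t = v⁻¹ * I.2.2 - 2 * a / 3 := by linarith
    rw [ht] at ht1
    field_simp at ht1
    linarith
  · intro h
    refine ⟨v⁻¹ * I.2.2 - 2 * a / 3, ?_, by ring⟩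
    field_simp
    linarith
end

section
/- Let a > 0 and X ∈ ℝ with −√a < X < √a be fixed, and set A = a − X². For b < 0 let X' = X − b/2, a' = b²/4 − bX + a, f(b) = 5b²/12 − 2bX/3 + 1/2, V₂(b) = (a'²/2)(π/2 − arctan(X'/√A)) + ((2X'³ − 5a'X')/6)√A, and Ẽ(b) = (1/2)(π/2 − arctan(X'/√A)) + ((2X'³ − 5a'X')/(6a'²))√A + (2b·A^{5/2})/(9·f(b)·a'²), i.e. Ẽ(b) = E(b)/(f(b)·a'²) with E(b) = f(b)·V₂(b) + (2b/9)A^{5/2}. Then for every b < 0 with f(b) ≠ 0, Ẽ is differentiable at b with derivative Ẽ'(b) = P(b)·A^{5/2}/(108·a'³·f(b)²), where P(b) = 6X·b³ + (21 − 10a)·b² − 36X·b + 12a + 18. -/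
open Real

theorem stmt_7 (a X : ℝ) (ha : 0 < a)
    (h1 : -Real.sqrt a < X) (h2 : X < Real.sqrt a)
    (A : ℝ) (hA : A = a - X ^ 2)
    (f : ℝ → ℝ) (hf : ∀ b, f b = 5 * b ^ 2 / 12 - 2 * b * X / 3 + 1 / 2)
    (X' : ℝ → ℝ) (hX' : ∀ b, X' b = X - b / 2)
    (a' : ℝ → ℝ) (ha' : ∀ b, a' b = b ^ 2 / 4 - b * X + a)
    (V₂ : ℝ → ℝ)
    (hV₂ : ∀ b, V₂ b = a' b ^ 2 / 2 * (π / 2 - Real.arctan (X' b / Real.sqrt A)) +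
        (2 * X' b ^ 3 - 5 * a' b * X' b) / 6 * Real.sqrt A)
    (E : ℝ → ℝ)
    (hE : ∀ b, E b = f b * V₂ b + 2 * b / 9 * A ^ ((5 : ℝ) / 2))
    (Etil : ℝ → ℝ)
    (hEtil : ∀ b, Etil b =
      1 / 2 * (π / 2 - Real.arctan (X' b / Real.sqrt A)) +
        (2 * X' b ^ 3 - 5 * a' b * X' b) / (6 * a' b ^ 2) * Real.sqrt A +
        2 * b * A ^ ((5 : ℝ) / 2) / (9 * f b * a' b ^ 2))
    (P : ℝ → ℝ)
    (hP : ∀ b, P b = 6 * X * b ^ 3 + (21 - 10 * a) * b ^ 2 - 36 * X * b + 12 * a + 18) :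
    ∀ b < 0, f b ≠ 0 →
      Etil b = E b / (f b * a' b ^ 2) ∧
      HasDerivAt Etil (P b * A ^ ((5 : ℝ) / 2) / (108 * a' b ^ 3 * f b ^ 2)) b := by
  have hApos : 0 < A := by
    rw [hA, sub_pos]
    exact Real.sq_lt.mpr ⟨h1, h2⟩
  obtain ⟨s, hs⟩ : ∃ s, s = Real.sqrt A := ⟨_, rfl⟩
  have hs0 : 0 < s := hs ▸ Real.sqrt_pos.mpr hApos
  have hsA : A = s ^ 2 := by rw [hs, Real.sq_sqrt hApos.le]
  have hpow : A ^ ((5 : ℝ) / 2) = s ^ 5 := by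
    rw [hs, Real.sqrt_eq_rpow, ← Real.rpow_natCast, ← Real.rpow_mul hApos.le]
    norm_num
  have ha_eq : a = s ^ 2 + X ^ 2 := by linarith
  simp only [← hs, hpow] at hV₂ hE hEtil ⊢
  intro b _ hfb
  have ha'eq : a' b = s ^ 2 + X' b ^ 2 := by rw [ha', hX', ha_eq]; ring
  have ha'0 : a' b ≠ 0 := by rw [ha'eq]; positivity
  refine ⟨?_, ?_⟩
  · rw [hEtil, hE, hV₂]
    field_simp
  have hX'd : HasDerivAt X' (-1 / 2) b := by
    rw [funext hX']
    exact (((hasDerivAt_id b).div_const 2).const_sub X).congr_deriv (by ring)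
  have ha'd : HasDerivAt a' (-X' b) b := by
    rw [funext ha']
    refine (((((hasDerivAt_id b).pow 2).div_const 4).sub
      ((hasDerivAt_id b).mul_const X)).add_const a).congr_deriv ?_
    rw [hX']
    simp
    ring
  have hfd : HasDerivAt f (5 * b / 6 - 2 * X / 3) b := by
    rw [funext hf]
    refine ((((((hasDerivAt_id b).pow 2).const_mul 5).div_const 12).sub
      ((((hasDerivAt_id b).const_mul 2).mul_const X).div_const 3)).add_const
        (1 / 2)).congr_deriv ?_
    simp
    ring
  have harctan := (((hX'd.div_const s).arctan).const_sub (π / 2)).const_mul (1 / 2)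
  have hrat := ((((hX'd.pow 3).const_mul 2).sub ((ha'd.const_mul 5).mul hX'd)).div
    ((ha'd.pow 2).const_mul 6) (by simpa using ha'0)).mul_const s
  have hlast := (((hasDerivAt_id b).const_mul 2).mul_const (s ^ 5)).div
    ((hfd.const_mul 9).mul (ha'd.pow 2)) (by simpa using ⟨hfb, ha'0⟩)
  rw [funext hEtil]
  refine ((harctan.add hrat).add hlast).congr_deriv ?_
  have hfrac : 1 / (1 + (X' b / s) ^ 2) * (-1 / 2 / s) = -s / (2 * a' b) := by
    rw [ha'eq]
    field_simp
  rw [hfrac]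
  simp only [Pi.mul_apply, Pi.sub_apply, Pi.pow_apply, id, Nat.cast_ofNat, hP]
  have hb : b = 2 * (X - X' b) := by rw [hX']; ring
  have hfb_eq := hf b
  clear harctan hrat hlast hfrac hX'd ha'd hfd
  generalize X' b = x at *
  generalize f b = F at *
  generalize a' b = p at *
  field_simp
  subst hfb_eq
  subst ha'eq
  subst ha_eq
  rw [hb]
  ring
end

section
/- (Proposition 1.) Let a > 0, X ∈ ℝ with −√a < X < √a, A = a − X², and for b < 0 define E(b) = (5b²/12 − 2bX/3 + 1/2)·V₂(b) + (2b/9)·A^{5/2}, where V₂(b) = (a'²/2)(π/2 − arctan(X'/√A)) + ((2X'³ − 5a'X')/6)√A with X' = X − b/2 and a' = b²/4 − bX + a. Then E(b) tends to V₁/2 as b → 0⁻, where V₁ = (a²/2)(π/2 − arctan(X/√A)) + ((2X³ − 5aX)/6)√A > 0, and E(b) tends to −(4X/45)·A^{5/2} as b → −∞. -/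
open Real Filter

theorem mul_div_lt_arctan {u : ℝ} (hu : 0 < u) :
    u * (1 + 5 * u ^ 2 / 3) / (1 + u ^ 2) ^ 2 < arctan u := by
  let h : ℝ → ℝ := fun x ↦ arctan x - x * (1 + 5 * x ^ 2 / 3) / (1 + x ^ 2) ^ 2
  have hd : ∀ x, HasDerivAt h (8 / 3 * x ^ 4 / (1 + x ^ 2) ^ 3) x := by
    intro x
    have hx : (1 + x ^ 2) ≠ 0 := by positivity
    have hq : HasDerivAt (fun x : ℝ ↦ x ^ 2) (2 * x) x := by
      simpa using hasDerivAt_pow 2 x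
    have hn := (hasDerivAt_id' x).mul (((hq.const_mul 5).div_const 3).const_add 1)
    have hden := (hq.const_add 1).pow 2
    refine ((hasDerivAt_arctan x).sub (hn.div hden (pow_ne_zero 2 hx))).congr_deriv ?_
    simp only [Pi.mul_apply, Pi.pow_apply]
    field_simp
    ring
  have hm : StrictMonoOn h (Set.Ici 0) := by
    refine strictMonoOn_of_deriv_pos (convex_Ici 0)
      (fun x _ ↦ (hd x).continuousAt.continuousWithinAt) fun x hx ↦ ?_
    rw [interior_Ici, Set.mem_Ioi] at hx
    rw [(hd x).deriv]
    positivity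
  have := hm Set.self_mem_Ici hu.le hu
  simp only [h, arctan_zero] at this
  norm_num at this
  linarith

theorem abs_arctan_sub_taylor_le {u : ℝ} (hu : 0 ≤ u) :
    |arctan u - (u - u ^ 3 / 3 + u ^ 5 / 5)| ≤ u ^ 7 / 7 := by
  let p : ℝ → ℝ := fun x ↦ x - x ^ 3 / 3 + x ^ 5 / 5
  have hp : ∀ x, HasDerivAt (fun x ↦ p x - arctan x) (x ^ 6 / (1 + x ^ 2)) x := by
    intro x
    have hx : (1 + x ^ 2) ≠ 0 := by positivity
    refine ((((hasDerivAt_id' x).sub ((hasDerivAt_pow 3 x).div_const 3)).add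
      ((hasDerivAt_pow 5 x).div_const 5)).sub (hasDerivAt_arctan x)).congr_deriv ?_
    norm_num
    field_simp
    ring
  have hq : ∀ x, HasDerivAt (fun x ↦ x ^ 7 / 7 - (p x - arctan x))
      (x ^ 6 - x ^ 6 / (1 + x ^ 2)) x := by
    intro x
    refine (((hasDerivAt_pow 7 x).div_const 7).sub (hp x)).congr_deriv ?_
    norm_num
  have hpm : Monotone fun x ↦ p x - arctan x := by
    refine monotone_of_deriv_nonneg (fun x ↦ (hp x).differentiableAt) fun x ↦ ?_
    rw [(hp x).deriv]
    positivity
  have hqm : Monotone fun x ↦ x ^ 7 / 7 - (p x - arctan x) := by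
    refine monotone_of_deriv_nonneg (fun x ↦ (hq x).differentiableAt) fun x ↦ ?_
    rw [(hq x).deriv, sub_nonneg]
    exact div_le_self (by positivity) (by nlinarith [sq_nonneg x])
  have h₁ := hpm hu
  have h₂ := hqm hu
  simp only [p, arctan_zero] at h₁ h₂
  norm_num at h₁ h₂
  rw [abs_le]
  constructor <;> linarith

theorem arctan_eq_pi_div_two_sub_arctan_inv {t : ℝ} (ht : 0 < t) :
    arctan t = π / 2 - arctan t⁻¹ := by
  rw [arctan_inv_of_pos ht]
  ring

theorem sector_profile_pos (t : ℝ) :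
    0 < (1 + t ^ 2) ^ 2 / 2 * (π / 2 - arctan t) - (3 * t ^ 3 + 5 * t) / 6 := by
  rcases le_or_gt t 0 with ht | ht
  · have h₁ : 0 < (1 + t ^ 2) ^ 2 / 2 * (π / 2 - arctan t) :=
      mul_pos (by positivity) (sub_pos.2 (arctan_lt_pi_div_two t))
    nlinarith [mul_nonneg (neg_nonneg.2 ht) (sq_nonneg t)]
  · have h := mul_div_lt_arctan (inv_pos.2 ht)
    rw [arctan_eq_pi_div_two_sub_arctan_inv ht, sub_sub_cancel, sub_pos]
    calc (3 * t ^ 3 + 5 * t) / 6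
        = (1 + t ^ 2) ^ 2 / 2 * (t⁻¹ * (1 + 5 * t⁻¹ ^ 2 / 3) / (1 + t⁻¹ ^ 2) ^ 2) := by
          have : t ^ 2 + 1 ≠ 0 := by positivity
          field_simp
          ring
      _ < _ := by gcongr

theorem stmt_8 (a X : ℝ) (ha : 0 < a)
    (h1 : -Real.sqrt a < X) (h2 : X < Real.sqrt a)
    (A : ℝ) (hA : A = a - X ^ 2)
    (X' : ℝ → ℝ) (hX' : ∀ b, X' b = X - b / 2)
    (a' : ℝ → ℝ) (ha' : ∀ b, a' b = b ^ 2 / 4 - b * X + a)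
    (V₂ : ℝ → ℝ)
    (hV₂ : ∀ b, V₂ b = a' b ^ 2 / 2 * (π / 2 - Real.arctan (X' b / Real.sqrt A)) +
        (2 * X' b ^ 3 - 5 * a' b * X' b) / 6 * Real.sqrt A)
    (E : ℝ → ℝ)
    (hE : ∀ b, E b = (5 * b ^ 2 / 12 - 2 * b * X / 3 + 1 / 2) * V₂ b +
        2 * b / 9 * A ^ ((5 : ℝ) / 2))
    (V₁ : ℝ)
    (hV₁ : V₁ = a ^ 2 / 2 * (π / 2 - Real.arctan (X / Real.sqrt A)) +
        (2 * X ^ 3 - 5 * a * X) / 6 * Real.sqrt A) :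
    0 < V₁ ∧
    Tendsto E (nhdsWithin 0 (Set.Iio 0)) (nhds (V₁ / 2)) ∧
    Tendsto E atBot (nhds (-(4 * X) / 45 * A ^ ((5 : ℝ) / 2))) := by
  have hA0 : 0 < A := by
    have : X ^ 2 < a := sq_lt.2 ⟨h1, h2⟩
    linarith
  have hpow : A ^ ((5 : ℝ) / 2) = √A ^ 5 := by
    rw [sqrt_eq_rpow, ← rpow_mul_natCast hA0.le]
    norm_num
  obtain ⟨s, hs⟩ : ∃ s, s = √A := ⟨_, rfl⟩
  have hs0 : 0 < s := hs ▸ sqrt_pos.2 hA0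
  have hsA : s ^ 2 = A := hs ▸ sq_sqrt hA0.le
  have haX : a = X ^ 2 + s ^ 2 := by rw [hsA, hA]; ring
  rw [hpow]
  rw [← hs] at hV₁ ⊢
  simp only [hpow, ← hs] at hV₂ hE
  refine ⟨?_, ?_, ?_⟩
  · have hV : V₁ = s ^ 4 * ((1 + (X / s) ^ 2) ^ 2 / 2 * (π / 2 - arctan (X / s)) -
        (3 * (X / s) ^ 3 + 5 * (X / s)) / 6) := by
      rw [hV₁, haX]
      field_simp
      ring
    rw [hV]
    exact mul_pos (by positivity) (sector_profile_pos _)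
  · have hE' : E = fun b ↦ (5 * b ^ 2 / 12 - 2 * b * X / 3 + 1 / 2) *
        ((b ^ 2 / 4 - b * X + a) ^ 2 / 2 * (π / 2 - arctan ((X - b / 2) / s)) +
        (2 * (X - b / 2) ^ 3 - 5 * (b ^ 2 / 4 - b * X + a) * (X - b / 2)) / 6 * s) +
        2 * b / 9 * s ^ 5 := by
      funext b
      rw [hE, hV₂, hX', ha']
    have hc : Continuous E := by
      rw [hE']
      fun_prop
    have h0 : E 0 = V₁ / 2 := by
      rw [hE', hV₁]
      norm_num
      ring
    rw [← h0]
    exact hc.continuousAt.tendsto.mono_left nhdsWithin_le_nhds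
  · let u : ℝ → ℝ := fun b ↦ s / (X - b / 2)
    let ρ : ℝ → ℝ := fun b ↦ (arctan (u b) - (u b - u b ^ 3 / 3 + u b ^ 5 / 5)) / u b ^ 7
    let q : ℝ → ℝ := fun v ↦ 5 / 3 * s ^ 2 - 2 * X * s * v + (X ^ 2 / 3 + 1 / 2) * v ^ 2
    let G : ℝ → ℝ := fun v ↦ -(4 * X) / 45 * s ^ 5 +
      v * (s ^ 4 * (4 / 15 * (X ^ 2 / 3 + 1 / 2) + q v * (1 / 30 + v ^ 2 / 10)))
    let H : ℝ → ℝ := fun v ↦ v * (s ^ 4 * q v * ((1 + v ^ 2) ^ 2 / 2))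
    have hu : Tendsto u atBot (nhds 0) := by
      refine Tendsto.const_div_atTop ?_ s
      refine tendsto_atTop.2 fun r ↦ ?_
      filter_upwards [eventually_le_atBot (2 * (X - r))] with b hb
      linarith
    have hpos : ∀ᶠ b in atBot, 0 < u b := by
      filter_upwards [eventually_lt_atBot (2 * X)] with b hb
      exact div_pos hs0 (by linarith)
    have hG : Tendsto (fun b ↦ G (u b)) atBot (nhds (-(4 * X) / 45 * s ^ 5)) := by
      have hc : Continuous G := by fun_prop
      simpa [G, Function.comp_def] using (hc.tendsto 0).comp hu
    have hH : Tendsto (fun b ↦ H (u b)) atBot (nhds 0) := by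
      have hc : Continuous H := by fun_prop
      simpa [H, Function.comp_def] using (hc.tendsto 0).comp hu
    have hρ : ∀ᶠ b in atBot, |ρ b| ≤ 1 / 7 := by
      filter_upwards [hpos] with b hb
      have h7 : 0 < u b ^ 7 := by positivity
      rw [abs_div, abs_of_pos h7, div_le_iff₀ h7]
      linarith [abs_arctan_sub_taylor_le hb.le]
    have hHρ : Tendsto (fun b ↦ ρ b * H (u b)) atBot (nhds 0) :=
      bdd_le_mul_tendsto_zero' (1 / 7) hρ hH
    have hEq : (fun b ↦ G (u b) + ρ b * H (u b)) =ᶠ[atBot] E := by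
      filter_upwards [hpos] with b hb
      have hr : arctan (u b) = u b - u b ^ 3 / 3 + u b ^ 5 / 5 + ρ b * u b ^ 7 := by
        simp only [ρ]
        field_simp
        ring
      have hXu : X - b / 2 = s / u b := by
        simp only [u]
        rw [div_div_cancel₀ hs0.ne']
      have hb' : b = 2 * (X - s / u b) := by linarith
      have hat : arctan ((X - b / 2) / s) = π / 2 - arctan (u b) := by
        rw [arctan_eq_pi_div_two_sub_arctan_inv (t := (X - b / 2) / s), inv_div]
        rw [← inv_div]
        exact inv_pos.2 hb
      have ha'' : a' b = (s / u b) ^ 2 + s ^ 2 := by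
        rw [ha', ← hXu, haX]
        ring
      rw [hE, hV₂, ha'', hX', hat, hr, hXu]
      simp only [G, H, q]
      generalize ρ b = r at *
      generalize u b = v at *
      subst hb'
      field_simp
      ring
    exact (by simpa using hG.add hHρ : Tendsto _ _ _).congr' hEq
end

section
/- (Theorem 2(a).) Let a > 0 and X ∈ ℝ with −√a < X ≤ −√(15/8). Set A = a − X², P(b) = 6X·b³ + (21 − 10a)·b² − 36X·b + 12a + 18, b₁ = 4X/5 − (1/5)√(16X² − 30), b₂ = 4X/5 + (1/5)√(16X² − 30), and E(b) = (5b²/12 − 2bX/3 + 1/2)·V₂(b) + (2b/9)·A^{5/2} with V₂(b) = (a'²/2)(π/2 − arctan(X'/√A)) + ((2X'³ − 5a'X')/6)√A, X' = X − b/2, a' = b²/4 − bX + a. Then P has exactly two negative real zeros b̃₁ < b̃₂; moreover b̃₁ < b₁, and the equation E(b) = 0 has exactly two solutions b < 0, one lying in the open interval (b̃₁, b₁) and the other in (b₂, 0). -/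
open Real

/-- The normalized volume `V₂ / a'²` as a function of `t = X'`, with `s = √A`. -/
noncomputable def normalizedVolume (s t : ℝ) : ℝ :=
  (π / 2 - arctan (t / s)) / 2 - (3 * t ^ 3 + 5 * s ^ 2 * t) * s / (6 * (t ^ 2 + s ^ 2) ^ 2)

/-- The quadratic factor in front of `V₂` in the equilibrium function. -/
noncomputable def leadQuadratic (X b : ℝ) : ℝ := 5 * b ^ 2 / 12 - 2 * b * X / 3 + 1 / 2

/-- The equilibrium function divided by `f * a'²`, with `s = √A`. -/
noncomputable def normalizedEquilibrium (s X b : ℝ) : ℝ :=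
  normalizedVolume s (X - b / 2) +
    2 / 9 * s ^ 5 * b / (leadQuadratic X b * ((X - b / 2) ^ 2 + s ^ 2) ^ 2)

/-- The cubic governing the monotonicity of the normalized equilibrium function. -/
noncomputable def criticalCubic (a X b : ℝ) : ℝ :=
  6 * X * b ^ 3 + (21 - 10 * a) * b ^ 2 - 36 * X * b + 12 * a + 18

lemma hasDerivAt_normalizedVolume {s : ℝ} (hs : 0 < s) (t : ℝ) :
    HasDerivAt (normalizedVolume s) (-(4 / 3) * s ^ 5 / (t ^ 2 + s ^ 2) ^ 3) t := by
  have hpos : 0 < t ^ 2 + s ^ 2 := by positivity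
  have h1 : HasDerivAt (fun t : ℝ => arctan (t / s)) (1 / (1 + (t / s) ^ 2) * (1 / s)) t :=
    ((hasDerivAt_id t).div_const s).arctan
  have h2 : HasDerivAt (fun t : ℝ => (3 * t ^ 3 + 5 * s ^ 2 * t) * s)
      ((9 * t ^ 2 + 5 * s ^ 2) * s) t := by
    have := ((((hasDerivAt_id t).pow 3).const_mul 3).add
      ((hasDerivAt_id t).const_mul (5 * s ^ 2))).mul_const s
    refine this.congr_deriv ?_
    push_cast [id]; ring
  have h3 : HasDerivAt (fun t : ℝ => 6 * (t ^ 2 + s ^ 2) ^ 2)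
      (24 * t * (t ^ 2 + s ^ 2)) t := by
    have := (((((hasDerivAt_id t).pow 2).add_const (s ^ 2))).pow 2).const_mul 6
    refine this.congr_deriv ?_
    simp; ring
  have h4 := ((h1.const_sub (π / 2)).div_const 2).sub (h2.div h3 (by positivity))
  refine h4.congr_deriv ?_
  have h5 : s ^ 2 + t ^ 2 ≠ 0 := by positivity
  field_simp
  ring

lemma tendsto_normalizedVolume {s : ℝ} (hs : 0 < s) :
    Filter.Tendsto (normalizedVolume s) Filter.atTop (nhds 0) := by
  have h1 : Filter.Tendsto (fun t : ℝ => (π / 2 - arctan (t / s)) / 2) Filter.atTop (nhds 0) := by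
    have h : Filter.Tendsto (fun t : ℝ => arctan (t / s)) Filter.atTop (nhds (π / 2)) :=
      (tendsto_nhds_of_tendsto_nhdsWithin tendsto_arctan_atTop).comp
        (Filter.tendsto_id.atTop_div_const hs)
    simpa using (h.const_sub (π / 2)).div_const 2
  have h2 : Filter.Tendsto
      (fun t : ℝ => (3 * t ^ 3 + 5 * s ^ 2 * t) * s / (6 * (t ^ 2 + s ^ 2) ^ 2))
      Filter.atTop (nhds 0) := by
    have h0 : Filter.Tendsto (fun t : ℝ => s / t) Filter.atTop (nhds 0) :=
      Filter.Tendsto.div_atTop tendsto_const_nhds Filter.tendsto_id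
    refine squeeze_zero' ?_ ?_ h0
    · filter_upwards [Filter.eventually_gt_atTop 0] with t ht
      positivity
    · filter_upwards [Filter.eventually_gt_atTop 0] with t ht
      rw [div_le_div_iff₀ (by positivity) ht]
      have : 0 ≤ s * (3 * t ^ 4 + 7 * t ^ 2 * s ^ 2 + 6 * s ^ 4) := by positivity
      nlinarith
  rw [← sub_zero (0 : ℝ)]
  exact h1.sub h2

lemma normalizedVolume_pos {s : ℝ} (hs : 0 < s) (t : ℝ) : 0 < normalizedVolume s t := by
  have hanti : StrictAnti (normalizedVolume s) := by
    refine strictAnti_of_deriv_neg fun t => ?_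
    rw [(hasDerivAt_normalizedVolume hs t).deriv]
    have : 0 < t ^ 2 + s ^ 2 := by positivity
    have : 0 < (4 / 3) * s ^ 5 / (t ^ 2 + s ^ 2) ^ 3 := by positivity
    rw [neg_mul, neg_div]
    linarith
  have h1 := hanti.antitone.le_of_tendsto (tendsto_normalizedVolume hs) (t + 1)
  exact h1.trans_lt (hanti (by linarith))

lemma hasDerivAt_normalizedEquilibrium {s : ℝ} (hs : 0 < s) {X b : ℝ}
    (hf : leadQuadratic X b ≠ 0) :
    HasDerivAt (normalizedEquilibrium s X)
      (criticalCubic (s ^ 2 + X ^ 2) X b *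
        (s ^ 5 / (108 * ((X - b / 2) ^ 2 + s ^ 2) ^ 3 * leadQuadratic X b ^ 2))) b := by
  have hlin : HasDerivAt (fun b : ℝ => X - b / 2) (-(1 / 2)) b :=
    ((hasDerivAt_id b).div_const 2).const_sub X
  have h1 := (hasDerivAt_normalizedVolume hs (X - b / 2)).comp b hlin
  have hq : HasDerivAt (leadQuadratic X) ((5 * b - 4 * X) / 6) b := by
    have := (((((hasDerivAt_id b).pow 2).const_mul 5).div_const 12).sub
      ((((hasDerivAt_id b).const_mul 2).mul_const X).div_const 3)).add_const (1 / 2)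
    refine this.congr_deriv ?_
    simp; ring
  have hsq : HasDerivAt (fun b : ℝ => ((X - b / 2) ^ 2 + s ^ 2) ^ 2)
      (-2 * (X - b / 2) * ((X - b / 2) ^ 2 + s ^ 2)) b := by
    have := ((hlin.pow 2).add_const (s ^ 2)).pow 2
    refine this.congr_deriv ?_
    simp; ring
  have hpos : 0 < (X - b / 2) ^ 2 + s ^ 2 := by positivity
  have hnum : HasDerivAt (fun b : ℝ => 2 / 9 * s ^ 5 * b) (2 / 9 * s ^ 5) b := by
    simpa using (hasDerivAt_id b).const_mul (2 / 9 * s ^ 5)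
  have h2 := h1.add (hnum.div (hq.mul hsq) (mul_ne_zero hf (by positivity)))
  refine h2.congr_deriv ?_
  have hcubic : criticalCubic (s ^ 2 + X ^ 2) X b =
      72 * leadQuadratic X b ^ 2 + 24 * (leadQuadratic X b * ((X - b / 2) ^ 2 + s ^ 2)
        - b * ((5 * b - 4 * X) / 6) * ((X - b / 2) ^ 2 + s ^ 2)
        + 2 * b * leadQuadratic X b * (X - b / 2)) := by
    simp only [criticalCubic, leadQuadratic]; ring
  rw [hcubic]
  simp only [Pi.mul_apply]
  generalize leadQuadratic X b = f at *
  generalize hD : (X - b / 2) ^ 2 + s ^ 2 = D at *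
  generalize X - b / 2 = t at *
  have hD0 : D ≠ 0 := hpos.ne'
  field_simp
  ring

lemma tendsto_normalizedEquilibrium {s : ℝ} (hs : 0 < s) {X : ℝ} (hX : X < 0) :
    Filter.Tendsto (normalizedEquilibrium s X) Filter.atBot (nhds 0) := by
  have hT : Filter.Tendsto (fun b : ℝ => X - b / 2) Filter.atBot Filter.atTop := by
    have h := Filter.tendsto_atTop_add_const_left Filter.atBot X
      ((Filter.tendsto_neg_atBot_atTop (G := ℝ)).atTop_div_const (show (0 : ℝ) < 2 by norm_num))
    refine h.congr fun b => ?_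
    ring
  have h1 := (tendsto_normalizedVolume hs).comp hT
  have h2 : Filter.Tendsto (fun b : ℝ =>
      2 / 9 * s ^ 5 * b / (leadQuadratic X b * ((X - b / 2) ^ 2 + s ^ 2) ^ 2))
      Filter.atBot (nhds 0) := by
    have h0 : Filter.Tendsto (fun b : ℝ => 2 * s ^ 5 / (X - b / 2)) Filter.atBot (nhds 0) :=
      Filter.Tendsto.div_atTop tendsto_const_nhds hT
    refine squeeze_zero_norm' ?_ h0
    filter_upwards [hT.eventually_ge_atTop 1, Filter.eventually_le_atBot (4 * X),
      Filter.eventually_lt_atBot 0] with b hb hbX hb0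
    have hf : 1 / 2 ≤ leadQuadratic X b := by
      simp only [leadQuadratic]
      nlinarith
    have hbt : -b ≤ 4 * (X - b / 2) := by linarith
    generalize X - b / 2 = t at *
    have hD : t ^ 4 ≤ (t ^ 2 + s ^ 2) ^ 2 := by
      nlinarith [mul_nonneg (sq_nonneg t) (sq_nonneg s), sq_nonneg (s ^ 2)]
    have hden : 1 / 2 * t ^ 4 ≤ leadQuadratic X b * (t ^ 2 + s ^ 2) ^ 2 :=
      mul_le_mul hf hD (by positivity) (by linarith)
    have ht0 : 0 < t := by linarith
    have hden0 : 0 < leadQuadratic X b * (t ^ 2 + s ^ 2) ^ 2 :=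
      lt_of_lt_of_le (by positivity) hden
    rw [Real.norm_eq_abs, abs_div, abs_of_pos hden0, abs_mul, abs_of_neg hb0,
      abs_of_pos (by positivity : 0 < 2 / 9 * s ^ 5), div_le_div_iff₀ hden0 ht0]
    have ht2 : t ^ 2 ≤ t ^ 4 := pow_le_pow_right₀ hb (by norm_num)
    have h3 : 2 / 9 * (-b * t) ≤ 2 * (leadQuadratic X b * (t ^ 2 + s ^ 2) ^ 2) := by
      nlinarith [mul_le_mul_of_nonneg_right hbt ht0.le]
    nlinarith [mul_le_mul_of_nonneg_left h3 (by positivity : 0 ≤ s ^ 5)]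
  rw [← add_zero (0 : ℝ)]
  exact h1.add h2

lemma leadQuadratic_eq_of_root {X b c : ℝ} (hb : leadQuadratic X b = 0) (hc : b + c = 8 * X / 5)
    (x : ℝ) : leadQuadratic X x = 5 / 12 * ((x - b) * (x - c)) := by
  obtain rfl : c = 8 * X / 5 - b := by linarith
  simp only [leadQuadratic] at *
  linear_combination hb

/-- The critical cubic splits with two negative and one positive root. -/
lemma exists_criticalCubic_roots {a X b₁ b₂ : ℝ} (hX : X < -1) (hXa : X ^ 2 < a)
    (ha : 15 / 8 < a) (h12 : b₁ ≤ b₂) (hb₂ : b₂ < 0) (hsum : b₁ + b₂ = 8 * X / 5)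
    (hr₁ : leadQuadratic X b₁ = 0) (hr₂ : leadQuadratic X b₂ = 0) :
    ∃ r₁ r₂ r₃ : ℝ, r₁ < b₁ ∧ b₁ ≤ r₂ ∧ r₂ ≤ b₂ ∧ 0 < r₃ ∧
      ∀ b, criticalCubic a X b = 6 * X * ((b - r₁) * (b - r₂) * (b - r₃)) := by
  have hid : ∀ b, leadQuadratic X b = 0 → criticalCubic a X b =
      4 * (-b) * (5 * b - 4 * X) * ((X - b / 2) ^ 2 + (a - X ^ 2)) := by
    intro b hb
    have hexp : criticalCubic a X b =
      72 * leadQuadratic X b ^ 2 + 24 * (leadQuadratic X b * ((X - b / 2) ^ 2 + (a - X ^ 2))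
        - b * ((5 * b - 4 * X) / 6) * ((X - b / 2) ^ 2 + (a - X ^ 2))
        + 2 * b * leadQuadratic X b * (X - b / 2)) := by
      simp only [criticalCubic, leadQuadratic]; ring
    rw [hexp, hb]; ring
  have hA : 0 < a - X ^ 2 := by linarith
  have hcont : Continuous (criticalCubic a X) := by unfold criticalCubic; fun_prop
  have hb₁ : b₁ < 0 := by linarith
  have hP₁ : criticalCubic a X b₁ ≤ 0 := by
    rw [hid b₁ hr₁]
    have : 0 ≤ 4 * (-b₁) * ((X - b₁ / 2) ^ 2 + (a - X ^ 2)) :=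
      mul_nonneg (by linarith) (by positivity)
    nlinarith
  have hP₂ : 0 ≤ criticalCubic a X b₂ := by
    rw [hid b₂ hr₂]
    have : 0 ≤ 4 * (-b₂) * ((X - b₂ / 2) ^ 2 + (a - X ^ 2)) :=
      mul_nonneg (by linarith) (by positivity)
    nlinarith
  obtain ⟨r₂, ⟨h1r, hr2⟩, hPr₂⟩ :=
    intermediate_value_Icc h12 hcont.continuousOn ⟨hP₁, hP₂⟩
  have hr₂0 : r₂ < 0 := by linarith
  set Q : ℝ → ℝ := fun b => 6 * X * b ^ 2 + (21 - 10 * a + 6 * X * r₂) * b +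
    (-36 * X + (21 - 10 * a + 6 * X * r₂) * r₂) with hQ
  have hPQ : ∀ b, criticalCubic a X b = (b - r₂) * Q b := by
    intro b
    simp only [criticalCubic, hQ] at *
    linear_combination hPr₂
  have hQ₁ : 0 < Q b₁ := by
    rcases h12.lt_or_eq with h | h
    · have hneg : criticalCubic a X b₁ < 0 := by
        rw [hid b₁ hr₁]
        have : 0 < 4 * (-b₁) * ((X - b₁ / 2) ^ 2 + (a - X ^ 2)) :=
          mul_pos (by linarith) (by positivity)
        nlinarith
      rw [hPQ] at hneg
      nlinarith
    · have hr : r₂ = 4 * X / 5 := by linarith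
      have hb : b₁ = 4 * X / 5 := by linarith
      rw [hb] at hr₁ ⊢
      simp only [leadQuadratic, hQ, hr] at *
      have hXX : X ^ 2 = 15 / 8 := by linarith
      have : 0 < X * (96 / 5 - 16 * a) := mul_pos_of_neg_of_neg (by linarith) (by linarith)
      have e : X ^ 3 = 15 / 8 * X := by rw [pow_succ, hXX]
      ring_nf
      ring_nf at this
      rw [e]
      linarith
  have hXa' : -X < a := by nlinarith
  have hL : -(10 * a + 3) < b₁ := by linarith
  have hPL : 0 < criticalCubic a X (-(10 * a + 3)) := by
    have hM : 0 < 10 * a + 3 := by linarith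
    have e : criticalCubic a X (-(10 * a + 3)) =
        (-X - 1) * (10 * a + 3) * (6 * (10 * a + 3) ^ 2 - 36) +
        (10 * a + 3) * (5 * (10 * a + 3) ^ 2 - 36) + 24 * (10 * a + 3) ^ 2 + 12 * a + 18 := by
      simp only [criticalCubic]; ring
    have : (21 : ℝ) ≤ 10 * a + 3 := by linarith
    have h9 : 36 ≤ 5 * (10 * a + 3) ^ 2 := by nlinarith
    have p1 : 0 ≤ (-X - 1) * (10 * a + 3) * (6 * (10 * a + 3) ^ 2 - 36) :=
      mul_nonneg (mul_nonneg (by linarith) hM.le) (by nlinarith)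
    have p2 : 0 ≤ (10 * a + 3) * (5 * (10 * a + 3) ^ 2 - 36) :=
      mul_nonneg hM.le (by linarith)
    rw [e]
    positivity
  have hQL : Q (-(10 * a + 3)) < 0 := by
    rw [hPQ] at hPL
    nlinarith
  obtain ⟨r₁, ⟨-, hr1⟩, hQr₁⟩ := intermediate_value_Ioo hL.le
    (f := Q) (by rw [hQ]; fun_prop) ⟨hQL, hQ₁⟩
  have hXne : X ≠ 0 := by linarith
  set r₃ := -(21 - 10 * a + 6 * X * r₂) / (6 * X) - r₁ with hr₃
  have hQfac : ∀ b, Q b = 6 * X * ((b - r₁) * (b - r₃)) := by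
    intro b
    have hs : 6 * X * (r₃ + r₁) = -(21 - 10 * a + 6 * X * r₂) := by
      rw [hr₃]; field_simp; ring
    simp only [hQ] at hQr₁ ⊢
    linear_combination hQr₁ + (b - r₁) * hs
  have hfac : ∀ b, criticalCubic a X b = 6 * X * ((b - r₁) * (b - r₂) * (b - r₃)) := by
    intro b
    rw [hPQ, hQfac]; ring
  refine ⟨r₁, r₂, r₃, hr1, h1r, hr2, ?_, hfac⟩
  have h0 := hfac 0
  simp only [criticalCubic] at h0
  have hpos : 0 < (-X) * (r₁ * r₂) := mul_pos (by linarith)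
    (mul_pos_of_neg_of_neg (by linarith) hr₂0)
  by_contra hcon
  nlinarith

theorem stmt_9 (a X : ℝ) (ha : 0 < a)
    (h1 : -Real.sqrt a < X) (h2 : X ≤ -Real.sqrt (15 / 8))
    (A : ℝ) (hA : A = a - X ^ 2)
    (P : ℝ → ℝ)
    (hP : ∀ b, P b = 6 * X * b ^ 3 + (21 - 10 * a) * b ^ 2 - 36 * X * b + 12 * a + 18)
    (b₁ b₂ : ℝ)
    (hb₁ : b₁ = 4 * X / 5 - Real.sqrt (16 * X ^ 2 - 30) / 5)
    (hb₂ : b₂ = 4 * X / 5 + Real.sqrt (16 * X ^ 2 - 30) / 5)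
    (X' : ℝ → ℝ) (hX' : ∀ b, X' b = X - b / 2)
    (a' : ℝ → ℝ) (ha' : ∀ b, a' b = b ^ 2 / 4 - b * X + a)
    (V₂ : ℝ → ℝ)
    (hV₂ : ∀ b, V₂ b = a' b ^ 2 / 2 * (π / 2 - Real.arctan (X' b / Real.sqrt A)) +
        (2 * X' b ^ 3 - 5 * a' b * X' b) / 6 * Real.sqrt A)
    (E : ℝ → ℝ)
    (hE : ∀ b, E b = (5 * b ^ 2 / 12 - 2 * b * X / 3 + 1 / 2) * V₂ b +
        2 * b / 9 * A ^ ((5 : ℝ) / 2)) :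
    ∃ bt₁ bt₂ : ℝ, bt₁ < bt₂ ∧ bt₂ < 0 ∧ P bt₁ = 0 ∧ P bt₂ = 0 ∧
      (∀ b < 0, P b = 0 → b = bt₁ ∨ b = bt₂) ∧
      bt₁ < b₁ ∧
      ∃ s₁ ∈ Set.Ioo bt₁ b₁, ∃ s₂ ∈ Set.Ioo b₂ (0 : ℝ),
        E s₁ = 0 ∧ E s₂ = 0 ∧ ∀ b < 0, E b = 0 → b = s₁ ∨ b = s₂ := by
  have hX0 : X < -1 := by
    have : 1 < √(15 / 8) := by rw [Real.lt_sqrt (by norm_num)]; norm_num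
    linarith
  have hXneg : X < 0 := by linarith
  have hX2 : 15 / 8 ≤ X ^ 2 := by
    have h := Real.sq_sqrt (show (0 : ℝ) ≤ 15 / 8 by norm_num)
    nlinarith [Real.sqrt_nonneg (15 / 8)]
  have hXa : X ^ 2 < a := by
    have h := Real.sq_sqrt ha.le
    nlinarith [Real.sqrt_nonneg a]
  have hA0 : 0 < A := by linarith
  set s := √A with hs_def
  have hs : 0 < s := Real.sqrt_pos.2 hA0
  have hs2 : s ^ 2 = A := Real.sq_sqrt hA0.le
  have has : a = s ^ 2 + X ^ 2 := by linarith
  have hpow : A ^ ((5 : ℝ) / 2) = s ^ 5 := by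
    rw [hs_def, Real.sqrt_eq_rpow, ← Real.rpow_natCast, ← Real.rpow_mul hA0.le]
    norm_num
  have hrt := Real.sq_sqrt (show (0 : ℝ) ≤ 16 * X ^ 2 - 30 by linarith)
  have hrt0 := Real.sqrt_nonneg (16 * X ^ 2 - 30)
  set d := √(16 * X ^ 2 - 30)
  have h12 : b₁ ≤ b₂ := by linarith
  have hb₂0 : b₂ < 0 := by
    have : d < -(4 * X) := by nlinarith
    linarith
  have hsum : b₁ + b₂ = 8 * X / 5 := by linarith
  have hr₁ : leadQuadratic X b₁ = 0 := by
    rw [leadQuadratic, hb₁]; linear_combination hrt / 60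
  have hr₂ : leadQuadratic X b₂ = 0 := by
    rw [leadQuadratic, hb₂]; linear_combination hrt / 60
  have hquad := leadQuadratic_eq_of_root hr₁ hsum
  have hPc : ∀ b, P b = criticalCubic a X b := hP
  have hW := normalizedVolume_pos hs
  have hD : ∀ b, 0 < (X - b / 2) ^ 2 + s ^ 2 := fun b => by positivity
  have hEW : ∀ b, E b = leadQuadratic X b * (((X - b / 2) ^ 2 + s ^ 2) ^ 2 *
      normalizedVolume s (X - b / 2)) + 2 / 9 * s ^ 5 * b := by
    intro b
    have ha'b : a' b = (X - b / 2) ^ 2 + s ^ 2 := by rw [ha', has]; ring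
    have hDb := (hD b).ne'
    rw [hE, hpow, hV₂, ha'b, hX', leadQuadratic, normalizedVolume]
    field_simp
    ring
  have hEG : ∀ b, leadQuadratic X b ≠ 0 → E b = leadQuadratic X b *
      ((X - b / 2) ^ 2 + s ^ 2) ^ 2 * normalizedEquilibrium s X b := by
    intro b hb
    have hDb := (hD b).ne'
    rw [hEW, normalizedEquilibrium]
    field_simp
  have hWcont : Continuous (normalizedVolume s) :=
    continuous_iff_continuousAt.2 fun t => (hasDerivAt_normalizedVolume hs t).continuousAt
  have hEcont : Continuous E := by
    rw [funext hEW]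
    unfold leadQuadratic
    fun_prop
  obtain ⟨r₁, r₂, r₃, hr1, h1r, hr2, hr3, hfac⟩ :=
    exists_criticalCubic_roots hX0 hXa (by linarith) h12 hb₂0 hsum hr₁ hr₂
  have hqpos₁ : ∀ b, b < b₁ → 0 < leadQuadratic X b := fun b hb => by
    rw [hquad]
    have := mul_pos_of_neg_of_neg (sub_neg.2 hb) (sub_neg.2 (hb.trans_le h12))
    linarith
  have hqpos₂ : ∀ b, b₂ < b → 0 < leadQuadratic X b := fun b hb => by
    rw [hquad]
    have := mul_pos (sub_pos.2 (h12.trans_lt hb)) (sub_pos.2 hb)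
    linarith
  have hGcont : ∀ S : Set ℝ, (∀ b ∈ S, 0 < leadQuadratic X b) →
      ContinuousOn (normalizedEquilibrium s X) S := fun S hS b hb =>
    (hasDerivAt_normalizedEquilibrium hs (hS b hb).ne').continuousAt.continuousWithinAt
  have hfactor : ∀ b, 0 < leadQuadratic X b →
      0 < s ^ 5 / (108 * ((X - b / 2) ^ 2 + s ^ 2) ^ 3 * leadQuadratic X b ^ 2) := fun b hb => by
    have := hD b
    positivity
  have hmono₁ : StrictMonoOn (normalizedEquilibrium s X) (Set.Iic r₁) := by
    refine strictMonoOn_of_deriv_pos (convex_Iic _)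
      (hGcont _ fun b hb => hqpos₁ b (lt_of_le_of_lt hb hr1)) fun b hb => ?_
    rw [interior_Iic, Set.mem_Iio] at hb
    have hq := hqpos₁ b (hb.trans hr1)
    rw [(hasDerivAt_normalizedEquilibrium hs hq.ne').deriv, ← has, hfac]
    refine mul_pos (mul_pos_of_neg_of_neg (by linarith) (mul_neg_of_pos_of_neg
      (mul_pos_of_neg_of_neg ?_ ?_) ?_)) (hfactor b hq) <;> linarith
  have hanti : StrictAntiOn (normalizedEquilibrium s X) (Set.Ioo r₁ b₁) := by
    refine strictAntiOn_of_deriv_neg (convex_Ioo _ _)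
      (hGcont _ fun b hb => hqpos₁ b hb.2) fun b hb => ?_
    rw [interior_Ioo] at hb
    obtain ⟨hb1, hb2⟩ := hb
    have hq := hqpos₁ b hb2
    rw [(hasDerivAt_normalizedEquilibrium hs hq.ne').deriv, ← has, hfac]
    refine mul_neg_of_neg_of_pos (mul_neg_of_neg_of_pos (by linarith) (mul_pos_of_neg_of_neg
      (mul_neg_of_pos_of_neg ?_ ?_) ?_)) (hfactor b hq) <;> linarith
  have hmono₂ : StrictMonoOn (normalizedEquilibrium s X) (Set.Ioo b₂ 0) := by
    refine strictMonoOn_of_deriv_pos (convex_Ioo _ _)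
      (hGcont _ fun b hb => hqpos₂ b hb.1) fun b hb => ?_
    rw [interior_Ioo] at hb
    obtain ⟨hb1, hb2⟩ := hb
    have hq := hqpos₂ b hb1
    rw [(hasDerivAt_normalizedEquilibrium hs hq.ne').deriv, ← has, hfac]
    refine mul_pos (mul_pos_of_neg_of_neg (by linarith) (mul_neg_of_pos_of_neg
      (mul_pos ?_ ?_) ?_)) (hfactor b hq) <;> linarith
  have hEpos : ∀ b ≤ r₁, 0 < E b := by
    intro b hb
    have hq := hqpos₁ b (hb.trans_lt hr1)
    rw [hEG b hq.ne']
    refine mul_pos (mul_pos hq (pow_pos (hD b) 2)) ?_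
    have hlt : normalizedEquilibrium s X (b - 1) < normalizedEquilibrium s X b :=
      hmono₁ (Set.mem_Iic.2 (by linarith)) hb (by linarith)
    refine lt_of_le_of_lt (le_of_tendsto (tendsto_normalizedEquilibrium hs hXneg) ?_) hlt
    filter_upwards [Filter.eventually_le_atBot (b - 1)] with y hy
    exact hmono₁.monotoneOn (Set.mem_Iic.2 (by linarith)) (Set.mem_Iic.2 (by linarith)) hy
  have hEneg : ∀ b, b₁ ≤ b → b ≤ b₂ → E b < 0 := by
    intro b hb1 hb2
    have hq : leadQuadratic X b ≤ 0 := by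
      rw [hquad]
      have := mul_nonneg (sub_nonneg.2 hb1) (sub_nonneg.2 hb2)
      linarith
    rw [hEW]
    have p1 := mul_nonpos_of_nonpos_of_nonneg hq
      (mul_pos (pow_pos (hD b) 2) (hW (X - b / 2))).le
    have p2 : 2 / 9 * s ^ 5 * b < 0 := mul_neg_of_pos_of_neg (by positivity) (by linarith)
    linarith
  have hE0 : 0 < E 0 := by
    rw [hEW]
    have := mul_pos (hqpos₂ 0 hb₂0) (mul_pos (pow_pos (hD 0) 2) (hW (X - 0 / 2)))
    linarith
  obtain ⟨s₁, hs₁, hEs₁⟩ := intermediate_value_Ioo' hr1.le hEcont.continuousOn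
    ⟨hEneg b₁ le_rfl h12, hEpos r₁ le_rfl⟩
  obtain ⟨s₂, hs₂, hEs₂⟩ := intermediate_value_Ioo hb₂0.le hEcont.continuousOn
    ⟨hEneg b₂ h12 le_rfl, hE0⟩
  have hG0 : ∀ b, 0 < leadQuadratic X b → E b = 0 → normalizedEquilibrium s X b = 0 := by
    intro b hq hb
    rw [hEG b hq.ne'] at hb
    exact (mul_eq_zero.1 hb).resolve_left (mul_pos hq (pow_pos (hD b) 2)).ne'
  refine ⟨r₁, r₂, by linarith, by linarith, ?_, ?_, ?_, hr1, s₁, hs₁, s₂, hs₂, hEs₁, hEs₂, ?_⟩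
  · rw [hPc, hfac]; ring
  · rw [hPc, hfac]; ring
  · intro b hb hPb
    rw [hPc, hfac] at hPb
    have hroot := (mul_eq_zero.1 hPb).resolve_left (by linarith)
    rw [mul_eq_zero, mul_eq_zero] at hroot
    rcases hroot with (h | h) | h
    · exact Or.inl (by linarith)
    · exact Or.inr (by linarith)
    · linarith
  · intro b hb hEb
    rcases le_or_gt b r₁ with h | h
    · exact absurd hEb (hEpos b h).ne'
    rcases lt_or_ge b b₁ with h' | h'
    · left
      exact hanti.injOn ⟨h, h'⟩ hs₁
        ((hG0 b (hqpos₁ b h') hEb).trans (hG0 s₁ (hqpos₁ s₁ hs₁.2) hEs₁).symm)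
    rcases le_or_gt b b₂ with h'' | h''
    · exact absurd hEb (hEneg b h' h'').ne
    · right
      exact hmono₂.injOn ⟨h'', hb⟩ hs₂
        ((hG0 b (hqpos₂ b h'') hEb).trans (hG0 s₂ (hqpos₂ s₂ hs₂.1) hEs₂).symm)
end

section
/- (Theorem 2(d).) Let a > 0 and X ∈ ℝ with 0 < X < √a. Set A = a − X², P(b) = 6X·b³ + (21 − 10a)·b² − 36X·b + 12a + 18, and E(b) = (5b²/12 − 2bX/3 + 1/2)·V₂(b) + (2b/9)·A^{5/2} with V₂(b) = (a'²/2)(π/2 − arctan(X'/√A)) + ((2X'³ − 5a'X')/6)√A, X' = X − b/2, a' = b²/4 − bX + a. Then P has exactly one negative real zero b̃₁, and the equation E(b) = 0 has exactly one solution b < 0, which lies in the open interval (b̃₁, 0). -/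
open Real

/-- The normalised submerged volume, `V₂` divided by `((X - b / 2) ^ 2 + s ^ 2) ^ 2`,
as a function of `b`, with `s = √A`. -/
noncomputable def normVolume (X s b : ℝ) : ℝ :=
  (π / 2 - arctan ((X - b / 2) / s)) / 2 +
    (2 * (X - b / 2) ^ 3 - 5 * ((X - b / 2) ^ 2 + s ^ 2) * (X - b / 2)) * s /
      (6 * ((X - b / 2) ^ 2 + s ^ 2) ^ 2)

/-- The normalised equilibrium function: `E` divided by its quadratic factor and by
`((X - b / 2) ^ 2 + s ^ 2) ^ 2`, as a function of `b`, with `s = √A`. -/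
noncomputable def normEquilibrium (X s b : ℝ) : ℝ :=
  normVolume X s b + 2 * b * s ^ 5 /
    (9 * ((5 * b ^ 2 / 12 - 2 * b * X / 3 + 1 / 2) * ((X - b / 2) ^ 2 + s ^ 2) ^ 2))

lemma factor_pos {X b : ℝ} (hX : 0 < X) (hb : b ≤ 0) :
    0 < 5 * b ^ 2 / 12 - 2 * b * X / 3 + 1 / 2 := by
  nlinarith [mul_nonneg (neg_nonneg.2 hb) hX.le, sq_nonneg b]

lemma hasDerivAt_normVolume (X : ℝ) {s : ℝ} (hs : 0 < s) (b : ℝ) :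
    HasDerivAt (normVolume X s) (2 / 3 * s ^ 5 / ((X - b / 2) ^ 2 + s ^ 2) ^ 3) b := by
  have hq : 0 < (X - b / 2) ^ 2 + s ^ 2 := by positivity
  have hx : HasDerivAt (fun b : ℝ => X - b / 2) (-(1 / 2)) b := by
    simpa using ((hasDerivAt_id b).div_const 2).const_sub X
  have hd : HasDerivAt (fun b : ℝ => (X - b / 2) ^ 2 + s ^ 2)
      (2 * (X - b / 2) * (-(1 / 2))) b := by
    simpa using (hx.pow 2).add_const (s ^ 2)
  have h := ((((hx.div_const s).arctan).const_sub (π / 2)).div_const 2).add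
    (((((hx.pow 3).const_mul 2).sub ((hd.const_mul 5).mul hx)).mul_const s).div
      ((hd.pow 2).const_mul 6) (by simp only [Pi.pow_apply]; positivity))
  refine HasDerivAt.congr_deriv (show HasDerivAt (normVolume X s) _ b from h) ?_
  have h2 : 1 + ((X - b / 2) / s) ^ 2 = ((X - b / 2) ^ 2 + s ^ 2) / s ^ 2 := by
    field_simp; ring
  simp only [h2, Pi.pow_apply, Pi.mul_apply, Pi.sub_apply]
  generalize X - b / 2 = x at *
  push_cast
  field_simp
  ring

lemma hasDerivAt_normEquilibrium {X s b : ℝ} (hX : 0 < X) (hs : 0 < s) (hb : b ≤ 0) :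
    HasDerivAt (normEquilibrium X s)
      ((6 * X * b ^ 3 + (21 - 10 * (X ^ 2 + s ^ 2)) * b ^ 2 - 36 * X * b
          + 12 * (X ^ 2 + s ^ 2) + 18) *
        (s ^ 5 / (108 * ((X - b / 2) ^ 2 + s ^ 2) ^ 3 *
          (5 * b ^ 2 / 12 - 2 * b * X / 3 + 1 / 2) ^ 2))) b := by
  have hq : 0 < (X - b / 2) ^ 2 + s ^ 2 := by positivity
  have hf := factor_pos hX hb
  have hx : HasDerivAt (fun b : ℝ => X - b / 2) (-(1 / 2)) b := by
    simpa using ((hasDerivAt_id b).div_const 2).const_sub X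
  have hd : HasDerivAt (fun b : ℝ => (X - b / 2) ^ 2 + s ^ 2)
      (2 * (X - b / 2) * (-(1 / 2))) b := by
    simpa using (hx.pow 2).add_const (s ^ 2)
  have hfd : HasDerivAt (fun b : ℝ => 5 * b ^ 2 / 12 - 2 * b * X / 3 + 1 / 2)
      (5 * (2 * b) / 12 - 2 * X / 3) b := by
    simpa using (((((hasDerivAt_id b).pow 2).const_mul 5).div_const 12).sub
      ((((hasDerivAt_id b).const_mul 2).mul_const X).div_const 3)).add_const (1 / 2)
  have hn : HasDerivAt (fun b : ℝ => 2 * b * s ^ 5) (2 * s ^ 5) b := by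
    simpa using ((hasDerivAt_id b).const_mul 2).mul_const (s ^ 5)
  have h := (hasDerivAt_normVolume X hs b).add
    (hn.div ((hfd.mul (hd.pow 2)).const_mul 9)
      (by simp only [Pi.mul_apply, Pi.pow_apply]; positivity))
  refine HasDerivAt.congr_deriv (show HasDerivAt (normEquilibrium X s) _ b from h) ?_
  simp only [Pi.pow_apply, Pi.mul_apply]
  push_cast
  generalize hqd : (X - b / 2) ^ 2 + s ^ 2 = q at *
  generalize hfe : 5 * b ^ 2 / 12 - 2 * b * X / 3 + 1 / 2 = f at *
  have hs2 : X ^ 2 + s ^ 2 = q + b * X - b ^ 2 / 4 := by rw [← hqd]; ring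
  rw [hs2]
  field_simp
  rw [← hfe]
  ring

lemma tendsto_sub_half_atBot (X : ℝ) :
    Filter.Tendsto (fun b : ℝ => X - b / 2) Filter.atBot Filter.atTop := by
  have h : Filter.Tendsto (fun b : ℝ => b * (-(1 / 2))) Filter.atBot Filter.atTop :=
    Filter.tendsto_id.atBot_mul_const_of_neg (by norm_num)
  refine (Filter.tendsto_atTop_add_const_left _ X h).congr fun b => by ring

lemma strictMono_normVolume (X : ℝ) {s : ℝ} (hs : 0 < s) : StrictMono (normVolume X s) := by
  refine strictMono_of_deriv_pos fun b => ?_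
  rw [(hasDerivAt_normVolume X hs b).deriv]
  positivity

lemma normVolume_pos (X : ℝ) {s : ℝ} (hs : 0 < s) (b : ℝ) : 0 < normVolume X s b := by
  refine lt_of_le_of_lt ?_ (strictMono_normVolume X hs (sub_one_lt b))
  have hlim : Filter.Tendsto (fun c : ℝ => -(5 * s / 6) / (X - c / 2)) Filter.atBot (nhds 0) :=
    (tendsto_sub_half_atBot X).const_div_atTop _
  refine le_of_tendsto hlim ?_
  filter_upwards [Filter.eventually_le_atBot (b - 1),
    (tendsto_sub_half_atBot X).eventually_gt_atTop 0] with c hc hx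
  refine le_trans ?_ ((strictMono_normVolume X hs).monotone hc)
  have harc := arctan_lt_pi_div_two ((X - c / 2) / s)
  unfold normVolume
  generalize X - c / 2 = x at *
  have : -(5 * s / 6) / x ≤ (2 * x ^ 3 - 5 * (x ^ 2 + s ^ 2) * x) * s /
      (6 * (x ^ 2 + s ^ 2) ^ 2) := by
    rw [div_le_div_iff₀ hx (by positivity), ← sub_nonneg]
    have : 0 ≤ s * (2 * x ^ 4 + 5 * s ^ 2 * x ^ 2 + 5 * s ^ 4) := by positivity
    nlinarith
  linarith

lemma normEquilibrium_le {X s b : ℝ} (hX : 0 < X) (hs : 0 < s) (hb : b ≤ 0) :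
    normEquilibrium X s b ≤ (π / 2 - arctan ((X - b / 2) / s)) / 2 := by
  have hf := factor_pos hX hb
  have hx : 0 < X - b / 2 := by linarith
  unfold normEquilibrium normVolume
  generalize X - b / 2 = x at *
  have h1 : (2 * x ^ 3 - 5 * (x ^ 2 + s ^ 2) * x) * s / (6 * (x ^ 2 + s ^ 2) ^ 2) ≤ 0 := by
    refine div_nonpos_of_nonpos_of_nonneg ?_ (by positivity)
    have : 0 ≤ s * (3 * x ^ 3 + 5 * s ^ 2 * x) := by positivity
    nlinarith
  have h2 : 2 * b * s ^ 5 / (9 * ((5 * b ^ 2 / 12 - 2 * b * X / 3 + 1 / 2) *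
      (x ^ 2 + s ^ 2) ^ 2)) ≤ 0 := by
    refine div_nonpos_of_nonpos_of_nonneg ?_ (by positivity)
    exact mul_nonpos_of_nonpos_of_nonneg (by linarith) (by positivity)
  linarith

lemma cubic_cross_lt {X a b c : ℝ} (hX : 0 < X) (ha : 0 < a) (hbc : b < c) (hc : c < 0) :
    c ^ 2 * (6 * X * b ^ 3 + (21 - 10 * a) * b ^ 2 - 36 * X * b + 12 * a + 18) <
      b ^ 2 * (6 * X * c ^ 3 + (21 - 10 * a) * c ^ 2 - 36 * X * c + 12 * a + 18) := by
  have hbcp : 0 < b * c := mul_pos_of_neg_of_neg (hbc.trans hc) hc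
  have hs : 0 < -(b + c) := by linarith
  have : 0 < (c - b) * (6 * X * (b * c) ^ 2 + 36 * X * (b * c) + (12 * a + 18) * (-(b + c))) :=
    mul_pos (sub_pos.2 hbc) (by positivity)
  linarith

lemma exists_neg_root_cubic {X a : ℝ} (hX : 0 < X) (ha : 0 < a) :
    ∃ r < 0, 6 * X * r ^ 3 + (21 - 10 * a) * r ^ 2 - 36 * X * r + 12 * a + 18 = 0 := by
  obtain ⟨T, hT1, hT⟩ : ∃ T : ℝ, 1 ≤ T ∧ 39 + 36 * X + 12 * a ≤ X * T := by
    refine ⟨1 + (39 + 36 * X + 12 * a) / X, le_add_of_nonneg_right (by positivity), ?_⟩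
    rw [mul_add, mul_div_cancel₀ _ hX.ne']
    linarith
  have hcont : ContinuousOn (fun b : ℝ =>
      6 * X * b ^ 3 + (21 - 10 * a) * b ^ 2 - 36 * X * b + 12 * a + 18) (Set.Icc (-T) 0) := by
    fun_prop
  have hneg : 6 * X * (-T) ^ 3 + (21 - 10 * a) * (-T) ^ 2 - 36 * X * (-T) + 12 * a + 18 ≤ 0 := by
    have hT2 : T ≤ T ^ 2 := by nlinarith
    have h1 : 36 * X * T ≤ 36 * X * T ^ 2 := mul_le_mul_of_nonneg_left hT2 (by positivity)
    have h2 : 12 * a + 18 ≤ (12 * a + 18) * T ^ 2 :=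
      le_mul_of_one_le_right (by positivity) (hT1.trans hT2)
    have h3 := mul_le_mul_of_nonneg_right hT (sq_nonneg T)
    have h4 : 0 ≤ X * T * T ^ 2 := by positivity
    have h5 : 0 ≤ a * T ^ 2 := by positivity
    nlinarith
  obtain ⟨r, hr, hr0⟩ := intermediate_value_Icc (by linarith) hcont
    ⟨hneg, by norm_num; positivity⟩
  refine ⟨r, lt_of_le_of_ne hr.2 ?_, hr0⟩
  rintro rfl
  norm_num at hr0
  linarith

lemma normEquilibrium_neg {X s r b : ℝ} (hX : 0 < X) (hs : 0 < s) (hr : r < 0)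
    (hanti : StrictAntiOn (normEquilibrium X s) (Set.Iic r)) (hb : b ≤ r) :
    normEquilibrium X s b < 0 := by
  have hb1 : b - 1 ≤ r := by linarith
  refine (hanti hb1 hb (sub_one_lt b)).trans_le ?_
  have hlim : Filter.Tendsto (fun c : ℝ => (π / 2 - arctan ((X - c / 2) / s)) / 2)
      Filter.atBot (nhds 0) := by
    have h := ((tendsto_nhds_of_tendsto_nhdsWithin tendsto_arctan_atTop).comp
      ((tendsto_sub_half_atBot X).atTop_div_const hs))
    simpa using (h.const_sub (π / 2)).div_const 2
  refine ge_of_tendsto hlim ?_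
  filter_upwards [Filter.eventually_le_atBot (b - 1)] with c hc
  exact (hanti.antitoneOn (hc.trans hb1) hb1 hc).trans
    (normEquilibrium_le hX hs ((hc.trans hb1).trans hr.le))


theorem stmt_12 (a X : ℝ) (ha : 0 < a)
    (h1 : 0 < X) (h2 : X < Real.sqrt a)
    (A : ℝ) (hA : A = a - X ^ 2)
    (P : ℝ → ℝ)
    (hP : ∀ b, P b = 6 * X * b ^ 3 + (21 - 10 * a) * b ^ 2 - 36 * X * b + 12 * a + 18)
    (X' : ℝ → ℝ) (hX' : ∀ b, X' b = X - b / 2)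
    (a' : ℝ → ℝ) (ha' : ∀ b, a' b = b ^ 2 / 4 - b * X + a)
    (V₂ : ℝ → ℝ)
    (hV₂ : ∀ b, V₂ b = a' b ^ 2 / 2 * (π / 2 - Real.arctan (X' b / Real.sqrt A)) +
        (2 * X' b ^ 3 - 5 * a' b * X' b) / 6 * Real.sqrt A)
    (E : ℝ → ℝ)
    (hE : ∀ b, E b = (5 * b ^ 2 / 12 - 2 * b * X / 3 + 1 / 2) * V₂ b +
        2 * b / 9 * A ^ ((5 : ℝ) / 2)) :
    ∃ bt₁ : ℝ, bt₁ < 0 ∧ P bt₁ = 0 ∧ (∀ b < 0, P b = 0 → b = bt₁) ∧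
      ∃ s ∈ Set.Ioo bt₁ (0 : ℝ), E s = 0 ∧ ∀ b < 0, E b = 0 → b = s := by
  have hA0 : 0 < A := by
    rw [hA, sub_pos]
    exact (lt_sqrt h1.le).1 h2
  obtain ⟨s, hs, hsA⟩ : ∃ s, 0 < s ∧ √A = s := ⟨√A, sqrt_pos.2 hA0, rfl⟩
  have hAs : A = s ^ 2 := by rw [← hsA, sq_sqrt hA0.le]
  have haX : a = X ^ 2 + s ^ 2 := by linarith
  have hpow : A ^ ((5 : ℝ) / 2) = s ^ 5 := by
    rw [hAs, ← rpow_natCast s 2, ← rpow_mul hs.le, ← rpow_natCast s 5]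
    norm_num
  have hEG : ∀ b ≤ 0, E b = (5 * b ^ 2 / 12 - 2 * b * X / 3 + 1 / 2) *
      ((X - b / 2) ^ 2 + s ^ 2) ^ 2 * normEquilibrium X s b := by
    intro b hb
    have hf := factor_pos h1 hb
    have hq : 0 < (X - b / 2) ^ 2 + s ^ 2 := by positivity
    have haq : a' b = (X - b / 2) ^ 2 + s ^ 2 := by rw [ha', haX]; ring
    rw [hE, hV₂, hpow, hsA, haq, hX', normEquilibrium, normVolume]
    generalize (X - b / 2) ^ 2 + s ^ 2 = q at *
    generalize 5 * b ^ 2 / 12 - 2 * b * X / 3 + 1 / 2 = f at *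
    field_simp
  have hE0 : ∀ b ≤ 0, E b = 0 ↔ normEquilibrium X s b = 0 := by
    intro b hb
    have hf := factor_pos h1 hb
    rw [hEG b hb, mul_eq_zero, or_iff_right (by positivity)]
  obtain ⟨r, hr, hr0⟩ := exists_neg_root_cubic h1 ha
  rw [← hP] at hr0
  have hcross : ∀ b c, b < c → c < 0 → c ^ 2 * P b < b ^ 2 * P c := by
    intro b c hbc hc
    rw [hP, hP]
    exact cubic_cross_lt h1 ha hbc hc
  have hPneg : ∀ b < r, P b < 0 := by
    intro b hb
    have h := hcross b r hb hr
    rw [hr0, mul_zero] at h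
    exact neg_of_mul_neg_right h (sq_nonneg r)
  have hPpos : ∀ b, r < b → b < 0 → 0 < P b := by
    intro b hb hb0
    have h := hcross r b hb hb0
    rw [hr0, mul_zero] at h
    exact pos_of_mul_pos_right h (sq_nonneg r)
  have hder : ∀ b ≤ 0, ∃ k > 0, HasDerivAt (normEquilibrium X s) (P b * k) b := by
    intro b hb
    have hf := factor_pos h1 hb
    refine ⟨_, ?_, by rw [hP, haX]; exact hasDerivAt_normEquilibrium h1 hs hb⟩
    positivity
  have hcont : ContinuousOn (normEquilibrium X s) (Set.Iic 0) := fun b hb =>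
    (hder b hb).choose_spec.2.continuousAt.continuousWithinAt
  have hanti : StrictAntiOn (normEquilibrium X s) (Set.Iic r) := by
    refine strictAntiOn_of_deriv_neg (convex_Iic r)
      (hcont.mono (Set.Iic_subset_Iic.2 hr.le)) fun b hb => ?_
    rw [interior_Iic, Set.mem_Iio] at hb
    obtain ⟨k, hk, hd⟩ := hder b (hb.trans hr).le
    rw [hd.deriv]
    exact mul_neg_of_neg_of_pos (hPneg b hb) hk
  have hmono : StrictMonoOn (normEquilibrium X s) (Set.Icc r 0) := by
    refine strictMonoOn_of_deriv_pos (convex_Icc r 0)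
      (hcont.mono Set.Icc_subset_Iic_self) fun b hb => ?_
    rw [interior_Icc] at hb
    obtain ⟨k, hk, hd⟩ := hder b hb.2.le
    rw [hd.deriv]
    exact mul_pos (hPpos b hb.1 hb.2) hk
  have hneg : ∀ b ≤ r, normEquilibrium X s b < 0 := fun b hb =>
    normEquilibrium_neg h1 hs hr hanti hb
  have hpos : 0 < normEquilibrium X s 0 := by
    have := normVolume_pos X hs 0
    simpa [normEquilibrium] using this
  obtain ⟨t, ht, ht0⟩ := intermediate_value_Ioo hr.le (hcont.mono Set.Icc_subset_Iic_self)
    ⟨hneg r le_rfl, hpos⟩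
  refine ⟨r, hr, hr0, fun b hb hPb => ?_, t, ht, (hE0 t ht.2.le).2 ht0, fun b hb hEb => ?_⟩
  · rcases lt_trichotomy b r with h | h | h
    · exact absurd hPb (hPneg b h).ne
    · exact h
    · exact absurd hPb (hPpos b h hb).ne'
  · have hGb := (hE0 b hb.le).1 hEb
    rcases le_or_gt b r with h | h
    · exact absurd hGb (hneg b h).ne
    · exact hmono.injOn ⟨h.le, hb.le⟩ ⟨ht.1.le, ht.2.le⟩ (hGb.trans ht0.symm)
end

section
/- (Proposition 2.) Let a > 0 and put a₁ = (−213 + 198√11)/250. Let X ∈ ℝ with −√a < X < √a, A = a − X², and E(b) = (5b²/12 − 2bX/3 + 1/2)·V₂(b) + (2b/9)·A^{5/2} for b < 0, where V₂(b) = (a'²/2)(π/2 − arctan(X'/√A)) + ((2X'³ − 5a'X')/6)√A with X' = X − b/2, a' = b²/4 − bX + a. Then the equation E(b) = 0 has no solution b ∈ (−∞, 0) if one of the following holds: (a) a ≤ a₁ and X ∈ (−√a, 0); (b) a₁ < a ≤ 21/10 and X ∈ [X₁, 0); (c) 21/10 < a ≤ 3 and X ∈ [X₁, X₂]; where X₁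 = −√(γ + √δ/27), X₂ = −√(γ − √δ/27), γ = −11a²/54 + 5a/9 + 13/24, and δ = (3 − a)(a + 6)³. -/
open Real

/-- A cubic with critical points of opposite sign and non-positive discriminant is positive on
the negative half-line, except possibly at one point. -/
lemma exists_cubic_pos_of_discr_nonpos {X c d : ℝ} (hX : X < 0) (hd : 0 < d)
    (hD : 0 ≤ d * c ^ 3 / 243 + X ^ 2 * (d ^ 2 + 4 * c * d - 4 * c ^ 2 / 3) - 1152 * (X ^ 2) ^ 2) :
    ∃ u : ℝ, ∀ b < 0, b ≠ u → 0 < 6 * X * b ^ 3 + c * b ^ 2 - 36 * X * b + d := by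
  obtain ⟨u, v, hu, huv, hs⟩ : ∃ u v : ℝ, u < 0 ∧ u * v = -2 ∧ c = -9 * X * (u + v) := by
    have hr : (√((c / (9 * X)) ^ 2 + 8)) ^ 2 = (c / (9 * X)) ^ 2 + 8 := sq_sqrt (by positivity)
    set s := c / (9 * X) with hs
    have hc : c = s * (9 * X) := (div_mul_cancel₀ c (by linarith)).symm
    have hr0 := sqrt_nonneg (s ^ 2 + 8)
    refine ⟨(-s - √(s ^ 2 + 8)) / 2, (-s + √(s ^ 2 + 8)) / 2, ?_, ?_, ?_⟩
    · nlinarith [neg_abs_le s, lt_sqrt_of_sq_lt (show |s| ^ 2 < s ^ 2 + 8 by rw [sq_abs]; linarith)]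
    · nlinarith
    · rw [hc]; ring
  have hv : 0 < v := by nlinarith
  have hPv : 0 < X * (-18 * v - 3 * v ^ 3) + d := by
    have : 0 < -X * (18 * v + 3 * v ^ 3) := mul_pos (by linarith) (by positivity)
    linarith
  have hPu : 0 ≤ X * (-18 * u - 3 * u ^ 3) + d := by
    have hprod : 0 ≤ X ^ 2 * ((X * (-18 * v - 3 * v ^ 3) + d) * (X * (-18 * u - 3 * u ^ 3) + d)) := by
      refine hD.trans_eq ?_
      have hs2 : u ^ 2 + v ^ 2 = (u + v) ^ 2 + 4 := by linear_combination (-2) * huv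
      have hs3 : u ^ 3 + v ^ 3 = (u + v) ^ 3 + 6 * (u + v) := by
        linear_combination (-3) * (u + v) * huv
      have e : (X * (-18 * v - 3 * v ^ 3) + d) * (X * (-18 * u - 3 * u ^ 3) + d) =
          d ^ 2 - 3 * X * d * (6 * (u + v) + (u ^ 3 + v ^ 3))
            + 9 * X ^ 2 * (u * v) * (36 + 6 * (u ^ 2 + v ^ 2) + (u * v) ^ 2) := by ring
      rw [e, hs2, hs3, huv, hs]
      ring
    have hX2 : 0 < X ^ 2 := sq_pos_of_neg hX
    exact nonneg_of_mul_nonneg_right (nonneg_of_mul_nonneg_right hprod hX2) hPv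
  refine ⟨u, fun b hb hbu => ?_⟩
  have key : 6 * X * b ^ 3 + c * b ^ 2 - 36 * X * b + d =
      (X * (-18 * u - 3 * u ^ 3) + d) + -X * ((b - u) ^ 2 * (3 * (3 * v - u) - 6 * b)) := by
    rw [hs]
    linear_combination (9 * X * u - 18 * X * b) * huv
  have : 0 < (b - u) ^ 2 := by have := sub_ne_zero.2 hbu; positivity
  have := mul_pos (neg_pos.2 hX) (mul_pos this (show 0 < 3 * (3 * v - u) - 6 * b by linarith))
  linarith

/-- The quotient of the equilibrium function by the positive factor `q * a' ^ 2`, where `S = √A`. -/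
noncomputable def equilibriumQuotient (a X S b : ℝ) : ℝ :=
  (π / 2 - arctan ((X - b / 2) / S)) / 2 -
    (3 * (X - b / 2) ^ 3 + 5 * S ^ 2 * (X - b / 2)) * S / (6 * (b ^ 2 / 4 - b * X + a) ^ 2) +
    2 * b * S ^ 5 /
      (9 * ((5 * b ^ 2 / 12 - 2 * b * X / 3 + 1 / 2) * (b ^ 2 / 4 - b * X + a) ^ 2))

lemma hasDerivAt_equilibriumQuotient {a X S b : ℝ} (hS : 0 < S) (hSA : S ^ 2 = a - X ^ 2)
    (hq : 5 * b ^ 2 / 12 - 2 * b * X / 3 + 1 / 2 ≠ 0) :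
    HasDerivAt (equilibriumQuotient a X S)
      (S ^ 5 * (6 * X * b ^ 3 + (21 - 10 * a) * b ^ 2 - 36 * X * b + (12 * a + 18)) /
        (108 * ((5 * b ^ 2 / 12 - 2 * b * X / 3 + 1 / 2) ^ 2 *
          (b ^ 2 / 4 - b * X + a) ^ 3))) b := by
  have ha' : b ^ 2 / 4 - b * X + a = S ^ 2 + (X - b / 2) ^ 2 := by rw [hSA]; ring
  have ha0 : b ^ 2 / 4 - b * X + a ≠ 0 := by rw [ha']; positivity
  have dx : HasDerivAt (fun b : ℝ => X - b / 2) (-(1 / 2)) b := by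
    simpa using ((hasDerivAt_id b).div_const 2).const_sub X
  have dA : HasDerivAt (fun b : ℝ => b ^ 2 / 4 - b * X + a) (b / 2 - X) b := by
    have := ((((hasDerivAt_id b).pow 2).div_const 4).sub
      ((hasDerivAt_id b).mul_const X)).add_const a
    refine this.congr_deriv ?_
    simp; ring
  have dq : HasDerivAt (fun b : ℝ => 5 * b ^ 2 / 12 - 2 * b * X / 3 + 1 / 2)
      (5 * b / 6 - 2 * X / 3) b := by
    have := ((((((hasDerivAt_id b).pow 2).const_mul 5).div_const 12)).sub
      ((((hasDerivAt_id b).const_mul 2).mul_const X).div_const 3)).add_const (1 / 2)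
    refine this.congr_deriv ?_
    simp; ring
  have d1 := (((dx.div_const S).arctan).const_sub (π / 2)).div_const 2
  have d2 := ((((dx.pow 3).const_mul 3).add (dx.const_mul (5 * S ^ 2))).mul_const S).div
    ((dA.pow 2).const_mul 6) (by simpa using ha0)
  have d3 := (((hasDerivAt_id b).const_mul 2).mul_const (S ^ 5)).div
    ((dq.mul (dA.pow 2)).const_mul 9) (by simpa using ⟨by simpa using hq, ha0⟩)
  refine ((d1.sub d2).add d3).congr_deriv ?_
  have e1 : 1 + ((X - b / 2) / S) ^ 2 = (b ^ 2 / 4 - b * X + a) / S ^ 2 := by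
    rw [ha']; field_simp
  have e12 : -(1 / (1 + ((X - b / 2) / S) ^ 2) * (-(1 / 2) / S)) / 2 -
      ((3 * (3 * (X - b / 2) ^ 2 * -(1 / 2)) + 5 * S ^ 2 * -(1 / 2)) * S *
          (6 * (b ^ 2 / 4 - b * X + a) ^ 2) -
        (3 * (X - b / 2) ^ 3 + 5 * S ^ 2 * (X - b / 2)) * S *
          (6 * (2 * (b ^ 2 / 4 - b * X + a) * (b / 2 - X)))) /
        (6 * (b ^ 2 / 4 - b * X + a) ^ 2) ^ 2 =
      2 * S ^ 5 / (3 * (b ^ 2 / 4 - b * X + a) ^ 3) := by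
    rw [e1, show b / 2 - X = -(X - b / 2) by ring]
    set m := b ^ 2 / 4 - b * X + a
    set x := X - b / 2
    field_simp
    rw [ha']
    ring
  have e3 : (2 * S ^ 5 *
          (9 * ((5 * b ^ 2 / 12 - 2 * b * X / 3 + 1 / 2) * (b ^ 2 / 4 - b * X + a) ^ 2)) -
        2 * b * S ^ 5 * (9 * ((5 * b / 6 - 2 * X / 3) * (b ^ 2 / 4 - b * X + a) ^ 2 +
          (5 * b ^ 2 / 12 - 2 * b * X / 3 + 1 / 2) *
            (2 * (b ^ 2 / 4 - b * X + a) * (b / 2 - X))))) /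
        (9 * ((5 * b ^ 2 / 12 - 2 * b * X / 3 + 1 / 2) * (b ^ 2 / 4 - b * X + a) ^ 2)) ^ 2 =
      2 * S ^ 5 * ((5 * b ^ 2 / 12 - 2 * b * X / 3 + 1 / 2) * (b ^ 2 / 4 - b * X + a) -
          b * (5 * b / 6 - 2 * X / 3) * (b ^ 2 / 4 - b * X + a) -
          2 * b * (5 * b ^ 2 / 12 - 2 * b * X / 3 + 1 / 2) * (b / 2 - X)) /
        (9 * ((5 * b ^ 2 / 12 - 2 * b * X / 3 + 1 / 2) ^ 2 * (b ^ 2 / 4 - b * X + a) ^ 3)) := by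
    set m := b ^ 2 / 4 - b * X + a
    set q := 5 * b ^ 2 / 12 - 2 * b * X / 3 + 1 / 2
    field_simp
    ring
  calc _ = 2 * S ^ 5 / (3 * (b ^ 2 / 4 - b * X + a) ^ 3) + 2 * S ^ 5 *
        ((5 * b ^ 2 / 12 - 2 * b * X / 3 + 1 / 2) * (b ^ 2 / 4 - b * X + a) -
          b * (5 * b / 6 - 2 * X / 3) * (b ^ 2 / 4 - b * X + a) -
          2 * b * (5 * b ^ 2 / 12 - 2 * b * X / 3 + 1 / 2) * (b / 2 - X)) /
        (9 * ((5 * b ^ 2 / 12 - 2 * b * X / 3 + 1 / 2) ^ 2 *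
          (b ^ 2 / 4 - b * X + a) ^ 3)) := by
        rw [← e12, ← e3]
        simp only [id, Pi.pow_apply, Pi.mul_apply, Pi.add_apply, mul_one]
        push_cast
        ring
    _ = 2 * S ^ 5 * (3 * (5 * b ^ 2 / 12 - 2 * b * X / 3 + 1 / 2) ^ 2 +
        ((5 * b ^ 2 / 12 - 2 * b * X / 3 + 1 / 2) * (b ^ 2 / 4 - b * X + a) -
          b * (5 * b / 6 - 2 * X / 3) * (b ^ 2 / 4 - b * X + a) -
          2 * b * (5 * b ^ 2 / 12 - 2 * b * X / 3 + 1 / 2) * (b / 2 - X))) /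
        (9 * ((5 * b ^ 2 / 12 - 2 * b * X / 3 + 1 / 2) ^ 2 *
          (b ^ 2 / 4 - b * X + a) ^ 3)) := by
        set m := b ^ 2 / 4 - b * X + a
        set q := 5 * b ^ 2 / 12 - 2 * b * X / 3 + 1 / 2
        field_simp
        ring
    _ = _ := by
        rw [div_eq_div_iff (by positivity) (by positivity)]
        ring

lemma le_equilibriumQuotient {a X S b : ℝ} (hX : X < 0) (ha : 0 < a) (hS : 0 < S)
    (hSA : S ^ 2 = a - X ^ 2) (hq : 0 < 1 / 2 - 4 * X ^ 2 / 15) (hb : b < 4 * X) :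
    (10 * S / 3 + 32 * S ^ 5 / (9 * (1 / 2 - 4 * X ^ 2 / 15) * a)) / b ≤
      equilibriumQuotient a X S b := by
  have hb0 : b < 0 := by linarith
  have hbX : 0 < b * X := mul_pos_of_neg_of_neg hb0 hX
  have hx : -b / 4 < X - b / 2 := by linarith
  have hx0 : 0 < X - b / 2 := by linarith
  have ha' : b ^ 2 / 4 - b * X + a = S ^ 2 + (X - b / 2) ^ 2 := by rw [hSA]; ring
  have harc := arctan_lt_pi_div_two ((X - b / 2) / S)
  have hqb : 1 / 2 - 4 * X ^ 2 / 15 ≤ 5 * b ^ 2 / 12 - 2 * b * X / 3 + 1 / 2 := by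
    nlinarith [sq_nonneg (b - 4 * X / 5)]
  have hcubic : (3 * (X - b / 2) ^ 3 + 5 * S ^ 2 * (X - b / 2)) * S /
      (6 * (b ^ 2 / 4 - b * X + a) ^ 2) ≤ 10 * S / 3 / -b := by
    rw [ha']
    set x := X - b / 2
    calc _ ≤ 5 * S / (6 * x) := by
          rw [div_le_div_iff₀ (by positivity) (by positivity)]
          have : 0 ≤ S * (12 * x ^ 4 + 30 * S ^ 2 * x ^ 2 + 30 * S ^ 4) := by positivity
          linarith
      _ ≤ 10 * S / 3 / -b := by
          rw [div_div, div_le_div_iff₀ (by positivity) (by linarith)]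
          nlinarith
  have hfrac : 2 * -b * S ^ 5 / (9 * ((5 * b ^ 2 / 12 - 2 * b * X / 3 + 1 / 2) *
      (b ^ 2 / 4 - b * X + a) ^ 2)) ≤
      32 * S ^ 5 / (9 * (1 / 2 - 4 * X ^ 2 / 15) * a) / -b := by
    have hm : a * (b ^ 2 / 16) ≤ (b ^ 2 / 4 - b * X + a) ^ 2 := by
      have hma : a ≤ b ^ 2 / 4 - b * X + a := by nlinarith
      have hmb : b ^ 2 / 16 ≤ b ^ 2 / 4 - b * X + a := by nlinarith
      rw [sq (b ^ 2 / 4 - b * X + a)]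
      exact mul_le_mul hma hmb (by positivity) (ha.le.trans hma)
    set q := 1 / 2 - 4 * X ^ 2 / 15
    have hb2 : 0 < b ^ 2 := sq_pos_of_neg hb0
    calc _ ≤ 2 * -b * S ^ 5 / (9 * (q * (a * (b ^ 2 / 16)))) := by
          have : 0 ≤ -b := by linarith
          have : 0 ≤ 5 * b ^ 2 / 12 - 2 * b * X / 3 + 1 / 2 := hq.le.trans hqb
          gcongr
      _ = _ := by
          have := hb0.ne
          field_simp
          ring
  have hsum : (10 * S / 3 + 32 * S ^ 5 / (9 * (1 / 2 - 4 * X ^ 2 / 15) * a)) / b =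
      -(10 * S / 3 / -b) - 32 * S ^ 5 / (9 * (1 / 2 - 4 * X ^ 2 / 15) * a) / -b := by
    rw [div_neg, div_neg, add_div]; ring
  have hneg : 2 * -b * S ^ 5 / (9 * ((5 * b ^ 2 / 12 - 2 * b * X / 3 + 1 / 2) *
      (b ^ 2 / 4 - b * X + a) ^ 2)) = -(2 * b * S ^ 5 /
      (9 * ((5 * b ^ 2 / 12 - 2 * b * X / 3 + 1 / 2) * (b ^ 2 / 4 - b * X + a) ^ 2))) := by
    ring
  rw [hsum, equilibriumQuotient]
  linarith

lemma equilibriumQuotient_pos {a X S b : ℝ} (hX : X < 0) (ha : 0 < a) (hS : 0 < S)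
    (hSA : S ^ 2 = a - X ^ 2) (hq : 0 < 1 / 2 - 4 * X ^ 2 / 15)
    (hP : ∃ u : ℝ, ∀ b < 0, b ≠ u →
      0 < 6 * X * b ^ 3 + (21 - 10 * a) * b ^ 2 - 36 * X * b + (12 * a + 18)) (hb : b < 0) :
    0 < equilibriumQuotient a X S b := by
  obtain ⟨u, hu⟩ := hP
  have hqb (b : ℝ) : 0 < 5 * b ^ 2 / 12 - 2 * b * X / 3 + 1 / 2 := by
    nlinarith [sq_nonneg (b - 4 * X / 5)]
  have hm (b : ℝ) : 0 < b ^ 2 / 4 - b * X + a := by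
    nlinarith [sq_nonneg (X - b / 2), pow_pos hS 2]
  have hder (b : ℝ) := hasDerivAt_equilibriumQuotient (b := b) hS hSA (hqb b).ne'
  have hpos (b : ℝ) (hb : b < 0) (hbu : b ≠ u) : 0 < deriv (equilibriumQuotient a X S) b := by
    rw [(hder b).deriv]
    have := hqb b
    have := hm b
    have := hu b hb hbu
    positivity
  have hcont : Continuous (equilibriumQuotient a X S) :=
    continuous_iff_continuousAt.2 fun b => (hder b).continuousAt
  have hmono₁ : StrictMonoOn (equilibriumQuotient a X S) (Set.Iic (min b u)) := by
    refine strictMonoOn_of_deriv_pos (convex_Iic _) hcont.continuousOn fun x hx => ?_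
    rw [interior_Iic, Set.mem_Iio, lt_min_iff] at hx
    exact hpos x (hx.1.trans hb) hx.2.ne
  have hmono₂ : StrictMonoOn (equilibriumQuotient a X S) (Set.Icc (min b u) b) := by
    refine strictMonoOn_of_deriv_pos (convex_Icc _ _) hcont.continuousOn fun x hx => ?_
    rw [interior_Icc, Set.mem_Ioo, min_lt_iff] at hx
    refine hpos x (hx.2.trans hb) ?_
    rcases hx.1 with h | h
    · exact absurd h hx.2.not_gt
    · exact h.ne'
  have hnonneg : 0 ≤ equilibriumQuotient a X S (min b u - 1) := by
    refine le_of_tendsto (f := fun x : ℝ =>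
      (10 * S / 3 + 32 * S ^ 5 / (9 * (1 / 2 - 4 * X ^ 2 / 15) * a)) / x)
      (tendsto_const_nhds.div_atBot Filter.tendsto_id) ?_
    filter_upwards [Filter.Iio_mem_atBot (4 * X), Filter.Iic_mem_atBot (min b u - 1)]
      with x hx hxb
    refine (le_equilibriumQuotient hX ha hS hSA hq hx).trans
      (hmono₁.monotoneOn ?_ ?_ hxb)
    · exact (Set.mem_Iic.1 hxb).trans (by linarith)
    · simp
  calc 0 ≤ equilibriumQuotient a X S (min b u - 1) := hnonneg
    _ < equilibriumQuotient a X S (min b u) :=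
      hmono₁ (by simp) (by simp) (by linarith)
    _ ≤ equilibriumQuotient a X S b :=
      hmono₂.monotoneOn (by simp) (by simp) (min_le_left _ _)

/-- The hypotheses place `X ^ 2` between the zeros of the discriminant. -/
lemma neg_and_sq_sub_le_of_cases {a X a₁ γ δ X₁ X₂ : ℝ} (ha : 0 < a)
    (ha₁ : a₁ = (-213 + 198 * √11) / 250) (hXa : X ^ 2 < a)
    (hγ : γ = -11 * a ^ 2 / 54 + 5 * a / 9 + 13 / 24)
    (hδ : δ = (3 - a) * (a + 6) ^ 3)
    (hX₁ : X₁ = -√(γ + √δ / 27))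
    (hX₂ : X₂ = -√(γ - √δ / 27))
    (hcase :
      (a ≤ a₁ ∧ X < 0) ∨
      (a₁ < a ∧ a ≤ 21 / 10 ∧ X₁ ≤ X ∧ X < 0) ∨
      (21 / 10 < a ∧ a ≤ 3 ∧ X₁ ≤ X ∧ X ≤ X₂)) :
    X < 0 ∧ 729 * (X ^ 2 - γ) ^ 2 ≤ δ := by
  have hγ₀ : 729 * γ ^ 2 - δ = (12 * a + 18) * (10 * a - 21) ^ 3 * 729 / 279936 := by
    rw [hγ, hδ]; ring
  have hsq {y : ℝ} (h : 729 * y ^ 2 ≤ δ) : |y| ≤ √δ / 27 := by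
    have := abs_le_sqrt (show (27 * y) ^ 2 ≤ δ by linarith)
    rw [abs_mul, abs_of_pos (by norm_num : (0 : ℝ) < 27)] at this
    linarith
  have hY₁ (h : X₁ ≤ X) (hX : X < 0) : X ^ 2 ≤ γ + √δ / 27 := by
    have := (le_sqrt' (neg_pos.2 hX)).1 (show -X ≤ √(γ + √δ / 27) by linarith)
    linarith [neg_sq X]
  have hγle (h : a ≤ 21 / 10) : γ ≤ √δ / 27 := by
    refine (le_abs_self γ).trans (hsq ?_)
    have : 0 ≤ (12 * a + 18) * (21 - 10 * a) ^ 3 :=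
      mul_nonneg (by linarith) (pow_nonneg (by linarith) 3)
    linarith
  have ha₁le (h : a ≤ a₁) : 250 * a + 213 ≤ 198 * √11 := by linarith
  have h11 : √11 ^ 2 = 11 := sq_sqrt (by norm_num)
  have hmain : a ≤ 3 ∧ X < 0 ∧ X ^ 2 ≤ γ + √δ / 27 ∧ γ - √δ / 27 ≤ X ^ 2 := by
    rcases hcase with ⟨h, hX⟩ | ⟨-, h, hX₁X, hX⟩ | ⟨h, h3, hX₁X, hXX₂⟩
    · have h' := ha₁le h
      have hsqa : (250 * a + 213) ^ 2 ≤ 431244 := by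
        have := pow_le_pow_left₀ (by linarith) h' 2
        rw [mul_pow, h11] at this
        linarith
      have ha2 : a ≤ 21 / 10 := by nlinarith
      refine ⟨by linarith, hX, ?_, by linarith [hγle ha2, sq_nonneg X]⟩
      have := (le_abs_self (a - γ)).trans (hsq (y := a - γ) ?_)
      · linarith
      · have e : 729 * (a - γ) ^ 2 - δ =
            ((250 * a + 213) ^ 2 - 431244) * (2 * a + 3) ^ 2 / 8000 := by
          rw [hγ, hδ]; ring
        nlinarith [sq_nonneg (2 * a + 3)]
    · exact ⟨by linarith, hX, hY₁ hX₁X hX, by linarith [hγle h, sq_nonneg X]⟩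
    · have hX0 : X ≤ 0 := hXX₂.trans (by rw [hX₂]; simp)
      have hY₂ : γ - √δ / 27 ≤ X ^ 2 := by
        rw [← neg_sq]
        exact (sqrt_le_left (by linarith)).1 (by linarith)
      have hX : X < 0 := by
        refine hX0.lt_of_ne fun hX => ?_
        have hγpos : 0 ≤ γ := by nlinarith
        have hδ0 : 0 ≤ δ := by
          rw [hδ]; exact mul_nonneg (by linarith) (by positivity)
        have := pow_le_pow_left₀ hγpos (show γ ≤ √δ / 27 by rw [hX] at hY₂; linarith) 2
        rw [div_pow, sq_sqrt hδ0] at this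
        have : 0 < (12 * a + 18) * (10 * a - 21) ^ 3 :=
          mul_pos (by linarith) (pow_pos (by linarith) 3)
        linarith
      exact ⟨h3, hX, hY₁ hX₁X hX, hY₂⟩
  obtain ⟨ha3, hX, hle, hge⟩ := hmain
  have hδ0 : 0 ≤ δ := by
    rw [hδ]; exact mul_nonneg (by linarith) (by positivity)
  have hY : 729 * (X ^ 2 - γ) ^ 2 ≤ δ := by
    have := sq_le_sq' (show -(√δ / 27) ≤ X ^ 2 - γ by linarith)
      (show X ^ 2 - γ ≤ √δ / 27 by linarith)
    rw [div_pow, sq_sqrt hδ0] at this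
    linarith
  exact ⟨hX, hY⟩

lemma sq_lt_of_sq_sub_le {a X γ δ : ℝ} (ha : 0 < a) (hXa : X ^ 2 < a)
    (hγ : γ = -11 * a ^ 2 / 54 + 5 * a / 9 + 13 / 24)
    (hδ : δ = (3 - a) * (a + 6) ^ 3) (hY : 729 * (X ^ 2 - γ) ^ 2 ≤ δ) : X ^ 2 < 15 / 8 := by
  by_contra! h
  have h1 : 0 ≤ 15 / 8 - γ := by rw [hγ]; nlinarith
  have h2 := pow_le_pow_left₀ h1 (show 15 / 8 - γ ≤ X ^ 2 - γ by linarith) 2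
  have h3 : 729 * (15 / 8 - γ) ^ 2 ≤ δ := by linarith
  rw [hγ, hδ] at h3
  nlinarith [sq_nonneg (a * (5 * a - 12)), mul_pos (show 0 < a - 15 / 8 by linarith) ha]

theorem stmt_13 (a X : ℝ) (ha : 0 < a)
    (a₁ : ℝ) (ha₁ : a₁ = (-213 + 198 * Real.sqrt 11) / 250)
    (h1 : -Real.sqrt a < X) (h2 : X < Real.sqrt a)
    (A : ℝ) (hA : A = a - X ^ 2)
    (X' : ℝ → ℝ) (hX' : ∀ b, X' b = X - b / 2)
    (a' : ℝ → ℝ) (ha' : ∀ b, a' b = b ^ 2 / 4 - b * X + a)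
    (V₂ : ℝ → ℝ)
    (hV₂ : ∀ b, V₂ b = a' b ^ 2 / 2 * (π / 2 - Real.arctan (X' b / Real.sqrt A)) +
        (2 * X' b ^ 3 - 5 * a' b * X' b) / 6 * Real.sqrt A)
    (E : ℝ → ℝ)
    (hE : ∀ b, E b = (5 * b ^ 2 / 12 - 2 * b * X / 3 + 1 / 2) * V₂ b +
        2 * b / 9 * A ^ ((5 : ℝ) / 2))
    (γ δ X₁ X₂ : ℝ)
    (hγ : γ = -11 * a ^ 2 / 54 + 5 * a / 9 + 13 / 24)
    (hδ : δ = (3 - a) * (a + 6) ^ 3)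
    (hX₁ : X₁ = -Real.sqrt (γ + Real.sqrt δ / 27))
    (hX₂ : X₂ = -Real.sqrt (γ - Real.sqrt δ / 27))
    (hcase :
      (a ≤ a₁ ∧ X < 0) ∨
      (a₁ < a ∧ a ≤ 21 / 10 ∧ X₁ ≤ X ∧ X < 0) ∨
      (21 / 10 < a ∧ a ≤ 3 ∧ X₁ ≤ X ∧ X ≤ X₂)) :
    ¬ ∃ b ∈ Set.Iio (0 : ℝ), E b = 0 := by
  rintro ⟨b, hb, hEb⟩
  rw [Set.mem_Iio] at hb
  have hXa : X ^ 2 < a := sq_lt.2 ⟨h1, h2⟩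
  have hApos : 0 < A := by linarith
  obtain ⟨hX, hY⟩ := neg_and_sq_sub_le_of_cases ha ha₁ hXa hγ hδ hX₁ hX₂ hcase
  have hX15 := sq_lt_of_sq_sub_le ha hXa hγ hδ hY
  have hP := exists_cubic_pos_of_discr_nonpos (c := 21 - 10 * a) (d := 12 * a + 18) hX
    (by linarith) (by rw [hγ, hδ] at hY; linarith)
  have hS : 0 < √A := sqrt_pos.2 hApos
  have hSA : √A ^ 2 = a - X ^ 2 := by rw [sq_sqrt hApos.le, hA]
  have hg := equilibriumQuotient_pos hX ha hS hSA (by linarith) hP hb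
  have hA5 : A ^ ((5 : ℝ) / 2) = √A ^ 5 := by
    rw [sqrt_eq_rpow, ← rpow_natCast, ← rpow_mul hApos.le]
    norm_num
  have hq : 0 < 5 * b ^ 2 / 12 - 2 * b * X / 3 + 1 / 2 := by
    nlinarith [sq_nonneg (b - 4 * X / 5)]
  have hm' : b ^ 2 / 4 - b * X + a = √A ^ 2 + (X - b / 2) ^ 2 := by rw [hSA]; ring
  have hm : 0 < b ^ 2 / 4 - b * X + a := by rw [hm']; positivity
  have hEg : E b = (5 * b ^ 2 / 12 - 2 * b * X / 3 + 1 / 2) * (b ^ 2 / 4 - b * X + a) ^ 2 *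
      equilibriumQuotient a X √A b := by
    have hcub : 2 * (X - b / 2) ^ 3 - 5 * (b ^ 2 / 4 - b * X + a) * (X - b / 2) =
        -(3 * (X - b / 2) ^ 3 + 5 * √A ^ 2 * (X - b / 2)) := by rw [hm']; ring
    rw [hE, hV₂, hX', ha', hA5, equilibriumQuotient, hcub]
    set m := b ^ 2 / 4 - b * X + a
    set q := 5 * b ^ 2 / 12 - 2 * b * X / 3 + 1 / 2
    field_simp
    ring
  have := mul_pos (mul_pos hq (pow_pos hm 2)) hg
  linarith
end

section
/- Let a > 0, 0 < σ < 1, and let b < 0 satisfy b² = (8a/3)(1 − √σ) − 2; set c = a√σ − b²/4. If a ≤ 15/8, then the archimedean condition a ≥ −b√a + c holds. If a > 15/8, then a ≥ −b√a + c holds if and only if √σ ≥ 13/25 − 3/(10a) + (6/5)·√(4/25 − 3/(10a)) or √σ ≤ 13/25 − 3/(10a) − (6/5)·√(4/25 − 3/(10a)). -/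
open Real

theorem stmt_14 (a σ b : ℝ) (ha : 0 < a) (hσ0 : 0 < σ) (hσ1 : σ < 1) (hb : b < 0)
    (hbeq : b ^ 2 = 8 * a / 3 * (1 - Real.sqrt σ) - 2)
    (c : ℝ) (hc : c = a * Real.sqrt σ - b ^ 2 / 4) :
    (a ≤ 15 / 8 → a ≥ -b * Real.sqrt a + c) ∧
    (15 / 8 < a →
      (a ≥ -b * Real.sqrt a + c ↔
        Real.sqrt σ ≥ 13 / 25 - 3 / (10 * a) +
            6 / 5 * Real.sqrt (4 / 25 - 3 / (10 * a)) ∨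
        Real.sqrt σ ≤ 13 / 25 - 3 / (10 * a) -
            6 / 5 * Real.sqrt (4 / 25 - 3 / (10 * a)))) := by
  have hr : 0 < √a := Real.sqrt_pos.2 ha
  have hra : √a ^ 2 = a := Real.sq_sqrt ha.le
  generalize √σ = s at *
  generalize √a = r at *
  have key : a ≥ -b * r + c ↔ -b * r ≤ 5 / 8 * b ^ 2 + 3 / 4 := by
    constructor <;> intro h <;> linarith
  rw [key]
  refine ⟨fun h => ?_, fun h => ?_⟩
  · refine (sq_le_sq₀ (mul_nonneg (neg_nonneg.2 hb.le) hr.le) (by positivity)).1 ?_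
    rw [mul_pow, hra, neg_sq]
    nlinarith [sq_nonneg (5 / 8 * b ^ 2 - 3 / 4), mul_le_mul_of_nonneg_left h (sq_nonneg b)]
  · have hD : 0 ≤ 4 / 25 - 3 / (10 * a) := by
      rw [sub_nonneg, div_le_iff₀ (by positivity)]
      linarith
    have hroots : (5 / 8 * b ^ 2 + 3 / 4) ^ 2 - (-b * r) ^ 2 = 25 / 9 * a ^ 2 *
        ((s - (13 / 25 - 3 / (10 * a))) ^ 2 - (6 / 5 * √(4 / 25 - 3 / (10 * a))) ^ 2) := by
      rw [mul_pow (-b), mul_pow (6 / 5), Real.sq_sqrt hD, hra, neg_sq, hbeq]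
      field_simp
      ring
    have habs : -b * r ≤ 5 / 8 * b ^ 2 + 3 / 4 ↔
        6 / 5 * √(4 / 25 - 3 / (10 * a)) ≤ |s - (13 / 25 - 3 / (10 * a))| := by
      rw [← sq_le_sq₀ (mul_nonneg (neg_nonneg.2 hb.le) hr.le) (by positivity),
        ← sq_le_sq₀ (a := 6 / 5 * √(4 / 25 - 3 / (10 * a))) (by positivity) (abs_nonneg _), sq_abs, ← sub_nonneg, hroots,
        mul_nonneg_iff_of_pos_left (by positivity), sub_nonneg]
    rw [habs, le_abs]
    constructor <;> rintro (h | h)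
    · left; linarith
    · right; linarith
    · left; linarith
    · right; linarith
end

section
/- Let a > 0 and 0 < σ < 1, put V = a²π/2, and for (c, b) ∈ ℝ × ℝ define β = √(b² + 1), a' = b²/4 + c, V' = a'²π/2, F₀ = V' − σV, f = 5b²/12 + 2(c − a)/3 + 1/2, E₀ = f·V', and U(c,b) = ((2a/3 − c)·σV + a'·V'/3)/β. Then the partial derivatives of U satisfy ∂U/∂c = F₀/β and ∂U/∂b = (b/β³)·((2a/3 − c)·F₀ + E₀). In particular, (c,b) is a stationary point of U if and only if F₀ = 0 and b·E₀ = 0. -/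
open Real

theorem stmt_15 (a σ : ℝ) (ha : 0 < a) (hσ0 : 0 < σ) (hσ1 : σ < 1)
    (V : ℝ) (hV : V = a ^ 2 * π / 2)
    (β : ℝ → ℝ) (hβ : ∀ b, β b = Real.sqrt (b ^ 2 + 1))
    (a' : ℝ → ℝ → ℝ) (ha' : ∀ c b, a' c b = b ^ 2 / 4 + c)
    (V' : ℝ → ℝ → ℝ) (hV' : ∀ c b, V' c b = a' c b ^ 2 * π / 2)
    (F₀ : ℝ → ℝ → ℝ) (hF₀ : ∀ c b, F₀ c b = V' c b - σ * V)
    (f : ℝ → ℝ → ℝ) (hf : ∀ c b, f c b = 5 * b ^ 2 / 12 + 2 * (c - a) / 3 + 1 / 2)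
    (E₀ : ℝ → ℝ → ℝ) (hE₀ : ∀ c b, E₀ c b = f c b * V' c b)
    (U : ℝ → ℝ → ℝ)
    (hU : ∀ c b, U c b = ((2 * a / 3 - c) * σ * V + a' c b * V' c b / 3) / β b) :
    ∀ c b : ℝ,
      HasDerivAt (fun c' => U c' b) (F₀ c b / β b) c ∧
      HasDerivAt (fun b' => U c b') (b / β b ^ 3 *
        ((2 * a / 3 - c) * F₀ c b + E₀ c b)) b ∧
      ((HasDerivAt (fun c' => U c' b) 0 c ∧ HasDerivAt (fun b' => U c b') 0 b) ↔
        (F₀ c b = 0 ∧ b * E₀ c b = 0)) := by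
  obtain rfl : β = fun b => Real.sqrt (b ^ 2 + 1) := funext hβ
  obtain rfl : a' = fun c b => b ^ 2 / 4 + c := funext₂ ha'
  obtain rfl : V' = fun c b => (b ^ 2 / 4 + c) ^ 2 * π / 2 := funext₂ hV'
  obtain rfl := funext₂ hF₀
  obtain rfl := funext₂ hf
  obtain rfl := funext₂ hE₀
  obtain rfl := funext₂ hU
  intro c b
  beta_reduce
  have hpos : 0 < b ^ 2 + 1 := by positivity
  have hs : 0 < √(b ^ 2 + 1) := Real.sqrt_pos.mpr hpos
  have hsq : √(b ^ 2 + 1) ^ 2 = b ^ 2 + 1 := Real.sq_sqrt hpos.le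
  have hc : HasDerivAt (fun c' => ((2 * a / 3 - c') * σ * V +
      (b ^ 2 / 4 + c') * ((b ^ 2 / 4 + c') ^ 2 * π / 2) / 3) / √(b ^ 2 + 1))
      (((b ^ 2 / 4 + c) ^ 2 * π / 2 - σ * V) / √(b ^ 2 + 1)) c := by
    have h₁ := (((hasDerivAt_id' c).const_sub (2 * a / 3)).mul_const σ).mul_const V
    have h₂ := (hasDerivAt_id' c).const_add (b ^ 2 / 4)
    have h₃ := (h₂.fun_mul (((h₂.fun_pow 2).mul_const π).div_const 2)).div_const 3
    refine ((h₁.fun_add h₃).div_const _).congr_deriv ?_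
    push_cast
    ring
  have hb : HasDerivAt (fun b' => ((2 * a / 3 - c) * σ * V +
      (b' ^ 2 / 4 + c) * ((b' ^ 2 / 4 + c) ^ 2 * π / 2) / 3) / √(b' ^ 2 + 1))
      (b / √(b ^ 2 + 1) ^ 3 * ((2 * a / 3 - c) * ((b ^ 2 / 4 + c) ^ 2 * π / 2 - σ * V) +
        (5 * b ^ 2 / 12 + 2 * (c - a) / 3 + 1 / 2) * ((b ^ 2 / 4 + c) ^ 2 * π / 2))) b := by
    have h₁ := (hasDerivAt_id' b).fun_pow 2
    have h₂ := (h₁.div_const 4).add_const c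
    have h₃ := (h₂.fun_mul (((h₂.fun_pow 2).mul_const π).div_const 2)).div_const 3
    have h₄ := (h₁.add_const 1).sqrt hpos.ne'
    refine ((h₃.const_add ((2 * a / 3 - c) * σ * V)).fun_div h₄ hs.ne').congr_deriv ?_
    generalize √(b ^ 2 + 1) = s at hs hsq ⊢
    push_cast
    field_simp
    simp only [hsq]
    ring
  refine ⟨hc, hb, fun ⟨h₁, h₂⟩ => ?_, fun ⟨h₁, h₂⟩ => ⟨hc.congr_deriv ?_, hb.congr_deriv ?_⟩⟩
  · have hF := (div_eq_zero_iff.mp (hc.unique h₁)).resolve_right hs.ne'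
    have h := hb.unique h₂
    rw [hF, mul_zero, zero_add, div_mul_eq_mul_div] at h
    exact ⟨hF, (div_eq_zero_iff.mp h).resolve_right (pow_ne_zero 3 hs.ne')⟩
  · rw [h₁, zero_div]
  · rw [h₁, mul_zero, zero_add, div_mul_eq_mul_div, h₂, zero_div]
end

section
/- Let a' > 0, V' > 0, c ∈ ℝ, b < 0, and β = √(b² + 1). Consider the symmetric 2×2 real matrix H = (V'/(a'β)) · [[2, b], [b, (5b⁴/8 + (c+1)b²/2)/β²]], where a' = b²/4 + c. Then det H = V'²·b²/(a'·β⁴) > 0, and H is positive definite. -/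
/-- Sylvester's criterion for real symmetric `2 × 2` matrices. -/
theorem posDef_fin_two_of_pos_of_det_pos {p q r : ℝ} (hp : 0 < p)
    (hdet : 0 < !![p, q; q, r].det) : !![p, q; q, r].PosDef := by
  rw [Matrix.det_fin_two_of] at hdet
  refine Matrix.PosDef.of_dotProduct_mulVec_pos ?_ fun x hx => ?_
  · ext i j
    fin_cases i <;> fin_cases j <;> simp
  · simp only [dotProduct, Matrix.mulVec, Fin.sum_univ_two, Pi.star_apply, star_trivial,
      Matrix.of_apply, Matrix.cons_val_zero, Matrix.cons_val_one]
    refine pos_of_mul_pos_right (a := p) ?_ hp.le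
    have hsq : p * (x 0 * (p * x 0 + q * x 1) + x 1 * (q * x 0 + r * x 1)) =
        (p * x 0 + q * x 1) ^ 2 + (p * r - q * q) * x 1 ^ 2 := by ring
    rw [hsq]
    by_cases h1 : x 1 = 0
    · have h0 : x 0 ≠ 0 := fun h0 => hx (by ext i; fin_cases i <;> simp [h0, h1])
      simp only [h1, mul_zero, add_zero]
      positivity
    · positivity

open Real

theorem stmt_17 (a' V' c b : ℝ) (ha' : 0 < a') (hV' : 0 < V') (hb : b < 0)
    (ha'eq : a' = b ^ 2 / 4 + c)
    (β : ℝ) (hβ : β = Real.sqrt (b ^ 2 + 1))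
    (H : Matrix (Fin 2) (Fin 2) ℝ)
    (hH : H = (V' / (a' * β)) •
      !![2, b; b, (5 * b ^ 4 / 8 + (c + 1) * b ^ 2 / 2) / β ^ 2]) :
    H.det = V' ^ 2 * b ^ 2 / (a' * β ^ 4) ∧ 0 < H.det ∧ H.PosDef := by
  have hβpos : 0 < β := hβ ▸ Real.sqrt_pos.mpr (by positivity)
  have hβsq : β ^ 2 = b ^ 2 + 1 := hβ ▸ Real.sq_sqrt (by positivity)
  have hminor : !![2, b; b, (5 * b ^ 4 / 8 + (c + 1) * b ^ 2 / 2) / β ^ 2].det =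
      a' * b ^ 2 / β ^ 2 := by
    rw [Matrix.det_fin_two_of]
    field_simp
    rw [hβsq, ha'eq]
    ring
  have hb2 : 0 < b ^ 2 := sq_pos_of_neg hb
  have hdet : H.det = V' ^ 2 * b ^ 2 / (a' * β ^ 4) := by
    rw [hH, Matrix.det_smul, hminor, Fintype.card_fin]
    field_simp
  refine ⟨hdet, hdet ▸ by positivity, ?_⟩
  rw [hH]
  refine (posDef_fin_two_of_pos_of_det_pos two_pos ?_).smul (by positivity)
  rw [hminor]
  positivity
end
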